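/- arXiv:1804.06983 — 5 statements merged into one kernel-verified Lean document; each statement's English description precedes it below -/
import Mathlib

section
/- Let X be an Asplund space and φ : X → ℝ ∪ {+∞} a proper lower semicontinuous function. If the set-valued operator ∂̂φ is quasimonotone, then φ is quasiconvex. -/
open Filter Topology

/-- `X` is an Asplund space: every closed separable subspace has separable dual. -/
def IsAsplund (X : Type*) [NormedAddCommGroup X] [NormedSpace ℝ X] : Prop :=
  ∀ Y : Submodule ℝ X, IsClosed (Y : Set X) →
    TopologicalSpace.SeparableSpace Y →
    TopologicalSpace.SeparableSpace (StrongDual ℝ Y)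

/-- Quasiconvexity of an extended-real-valued function. -/
def QuasiconvexFn {X : Type*} [AddCommGroup X] [Module ℝ X] (φ : X → EReal) : Prop :=
  ∀ x y : X, ∀ l : ℝ, 0 < l → l < 1 → φ (l • x + (1 - l) • y) ≤ max (φ x) (φ y)

/-- The Fréchet subdifferential of `φ` at `x`. -/
def FrechetSubdiff {X : Type*} [NormedAddCommGroup X] [NormedSpace ℝ X]
    (φ : X → EReal) (x : X) : Set (X →L[ℝ] ℝ) :=
  {xs | φ x ≠ ⊤ ∧ ∀ ε : ℝ, 0 < ε →
    ∀ᶠ y in 𝓝 x, φ x + ↑(xs (y - x)) - ↑(ε * ‖y - x‖) ≤ φ y}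

/-- `φ` is `α`-robustly quasiconvex. -/
def RobustlyQuasiconvex {X : Type*} [NormedAddCommGroup X] [NormedSpace ℝ X]
    (φ : X → EReal) (α : ℝ) : Prop :=
  ∀ vs : X →L[ℝ] ℝ, ‖vs‖ ≤ α → QuasiconvexFn (fun z => φ z + ↑(vs z))



theorem smooth_of_dual {Y : Type*} [NormedAddCommGroup Y] [NormedSpace ℝ Y]
    (P : StrongDual ℝ Y → ℝ) (C : ℝ) (hC : 0 < C)
    (hP1 : ∀ g, ‖g‖ ^ 2 ≤ P g) (hP2 : ∀ g, P g ≤ C * ‖g‖ ^ 2)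
    (hlsc : LowerSemicontinuous (fun g : WeakDual ℝ Y => P (WeakDual.toStrongDual g)))
    (hconv : ∀ f : StrongDual ℝ Y, ∀ ε : ℝ, 0 < ε → ∃ η : ℝ, 0 < η ∧ ∀ g : StrongDual ℝ Y,
      P f + P g - 2 * P ((1 / 2 : ℝ) • (f + g)) ≤ η → ‖g - f‖ ≤ ε) :
    ∃ (Q : Y → ℝ) (D : Y → StrongDual ℝ Y), Q 0 = 0 ∧ (∀ x, ‖x‖ ^ 2 ≤ (4 * C) * Q x) ∧
      (∀ x, Q x ≤ ‖x‖ ^ 2) ∧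
      (∀ x, HasFDerivAt Q (D x) x) ∧ (∀ x, ‖D x‖ ≤ ‖x‖) ∧ (∀ x, 0 ≤ D x x) := by
  have hP0 : P 0 = 0 := by
    have h1 := hP1 0
    have h2 := hP2 0
    simp at h1 h2
    linarith
  have hex : ∀ x : Y, ∃ f : StrongDual ℝ Y, ∀ g : StrongDual ℝ Y, g x - P g ≤ f x - P f := by
    intro x
    have hl : LowerSemicontinuous (fun g : WeakDual ℝ Y => P (WeakDual.toStrongDual g) + (-(g x))) := by
      apply hlsc.add
      exact (WeakDual.eval_continuous x).neg.lowerSemicontinuous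
    obtain ⟨f, hf, hmin⟩ := LowerSemicontinuousOn.exists_isMinOn
      (s := (WeakDual.toStrongDual (𝕜 := ℝ) (E := Y)) ⁻¹' Metric.closedBall 0 ‖x‖)
      ⟨0, by simp⟩ (WeakDual.isCompact_closedBall _ _) (hl.lowerSemicontinuousOn _)
    refine ⟨WeakDual.toStrongDual f, fun g => ?_⟩
    have key : ∀ g : StrongDual ℝ Y, ‖g‖ ≤ ‖x‖ →
        g x - P g ≤ (WeakDual.toStrongDual f) x - P (WeakDual.toStrongDual f) := by
      intro g hg
      have := hmin (a := StrongDual.toWeakDual g) (by simpa using hg)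
      change P (WeakDual.toStrongDual f) + (-((WeakDual.toStrongDual f) x)) ≤ P g + (- (g x)) at this
      linarith
    rcases le_total ‖g‖ ‖x‖ with h | h
    · exact key g h
    · have h0 := key 0 (by simp)
      rw [hP0] at h0
      simp only [zero_apply, sub_zero] at h0
      have h1 : g x ≤ ‖g‖ * ‖x‖ := (le_abs_self _).trans (g.le_opNorm x)
      have h2 := hP1 g
      nlinarith [norm_nonneg g]
  choose D hD using hex
  have hPnn : ∀ g, 0 ≤ P g := fun g => (sq_nonneg _).trans (hP1 g)
  have hval : ∀ x, 0 ≤ D x x - P (D x) := by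
    intro x
    have := hD x 0
    simpa [hP0] using this
  have hDn : ∀ x, ‖D x‖ ≤ ‖x‖ := by
    intro x
    have h1 : D x x ≤ ‖D x‖ * ‖x‖ := (le_abs_self _).trans ((D x).le_opNorm x)
    have h2 := hval x
    have h3 := hP1 (D x)
    by_contra h
    push Not at h
    nlinarith [norm_nonneg x]
  refine ⟨fun x => D x x - P (D x), D, ?_, ?_, ?_, ?_, hDn, ?_⟩
  · have := hval 0
    have h2 := hPnn (D 0)
    simp at this ⊢
    linarith
  · intro x
    by_cases hx : ‖x‖ = 0
    · rw [hx]
      have := hval x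
      simp only [ne_eq, OfNat.ofNat_ne_zero, not_false_eq_true, zero_pow]
      positivity
    · obtain ⟨g, hg, hgx⟩ := exists_dual_vector ℝ x hx
      have h1 := hD x ((‖x‖ / (2 * C)) • g)
      have h2 := hP2 ((‖x‖ / (2 * C)) • g)
      have h3 : ‖(‖x‖ / (2 * C)) • g‖ = ‖x‖ / (2 * C) := by
        rw [norm_smul, hg, mul_one, Real.norm_of_nonneg (by positivity)]
      rw [h3] at h2
      simp only [smul_apply, smul_eq_mul, hgx, RCLike.ofReal_real_eq_id, id_eq] at h1
      have h4 : ‖x‖ / (2 * C) * ‖x‖ - C * (‖x‖ / (2 * C)) ^ 2 ≤ D x x - P (D x) := by linarith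
      have h5 : ‖x‖ / (2 * C) * ‖x‖ - C * (‖x‖ / (2 * C)) ^ 2 = ‖x‖ ^ 2 / (4 * C) := by
        field_simp
        ring
      rw [h5, div_le_iff₀ (by positivity)] at h4
      linarith
  · intro x
    have h1 : D x x ≤ ‖D x‖ * ‖x‖ := (le_abs_self _).trans ((D x).le_opNorm x)
    have := hPnn (D x)
    have := hDn x
    simp only
    nlinarith [norm_nonneg x]
  · intro x
    rw [hasFDerivAt_iff_isLittleO, Asymptotics.isLittleO_iff]
    intro ε hε
    obtain ⟨η, hη, hc⟩ := hconv (D x) ε hε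
    have hev : ∀ᶠ y in 𝓝 x, ‖y - x‖ < min 1 (η / (2 * ‖x‖ + 1)) := by
      have : Tendsto (fun y => ‖y - x‖) (𝓝 x) (𝓝 0) := by
        have h : Continuous (fun y => ‖y - x‖) := by fun_prop
        simpa using h.tendsto x
      exact this.eventually (gt_mem_nhds (by positivity))
    filter_upwards [hev] with y hy
    have hy1 := hy.trans_le (min_le_left _ _)
    have hy2 := hy.trans_le (min_le_right _ _)
    rw [lt_div_iff₀ (by positivity)] at hy2
    have hyx : ‖y‖ ≤ ‖x‖ + 1 := by
      have : ‖y‖ ≤ ‖y - x‖ + ‖x‖ := by simpa using norm_add_le (y - x) x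
      linarith
    have e1 := hD y (D x)
    have e2 : D x y = D x x + D x (y - x) := by simp
    have e3 : D y y = D y x + D y (y - x) := by simp
    have b1 : |D x (y - x)| ≤ ‖x‖ * ‖y - x‖ :=
      ((D x).le_opNorm _).trans (by gcongr; exact hDn x)
    have b2 : |D y (y - x)| ≤ (‖x‖ + 1) * ‖y - x‖ :=
      ((D y).le_opNorm _).trans (by gcongr; exact (hDn y).trans hyx)
    have b1' := abs_le.1 b1
    have b2' := abs_le.1 b2
    have hm := hD x ((1 / 2 : ℝ) • (D x + D y))
    simp only [smul_apply, add_apply, smul_eq_mul] at hm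
    have hclose : ‖D y - D x‖ ≤ ε := by
      apply hc
      nlinarith
    have e4 : |(D y - D x) (y - x)| ≤ ε * ‖y - x‖ :=
      ((D y - D x).le_opNorm _).trans (by gcongr)
    have e5 : (D y - D x) (y - x) = D y (y - x) - D x (y - x) := by simp
    rw [e5] at e4
    have e4' := abs_le.1 e4
    have e6 := hD x (D y)
    rw [Real.norm_eq_abs, abs_le]
    constructor <;> linarith
  · intro x
    have := hval x
    have := hPnn (D x)
    linarith


theorem lsc_sq {α : Type*} [TopologicalSpace α] {f : α → ℝ} (hf : LowerSemicontinuous f)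
    (h0 : ∀ x, 0 ≤ f x) : LowerSemicontinuous (fun x => f x ^ 2) := by
  intro x y hy
  rcases lt_or_ge y 0 with h | h
  · exact Eventually.of_forall fun z => h.trans_le (sq_nonneg _)
  · have : Real.sqrt y < f x := (Real.sqrt_lt' (lt_of_le_of_ne (h0 x) (by
      intro hh; simp only [← hh] at hy; norm_num at hy; linarith))).2 hy
    filter_upwards [hf x _ this] with z hz
    calc y = Real.sqrt y ^ 2 := (Real.sq_sqrt h).symm
      _ < f z ^ 2 := by gcongr

theorem lsc_tsum {α : Type*} [TopologicalSpace α] {f : ℕ → α → ℝ}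
    (hf : ∀ n, LowerSemicontinuous (f n))
    (h0 : ∀ n x, 0 ≤ f n x) (hs : ∀ x, Summable (fun n => f n x)) :
    LowerSemicontinuous (fun x => ∑' n, f n x) := by
  intro x y hy
  obtain ⟨N, hN⟩ := ((hs x).hasSum.eventually (lt_mem_nhds hy)).exists
  filter_upwards [lowerSemicontinuous_sum (a := N) (fun i _ => hf i) x y hN] with z hz
  exact hz.trans_le ((hs z).sum_le_tsum _ (fun i _ => h0 i z))

theorem finite_net {Y : Type*} [NormedAddCommGroup Y] [NormedSpace ℝ Y]
    (F : ℕ → StrongDual ℝ Y) (x : ℕ → Y)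
    (hxd : ∀ z : Y, ‖z‖ ≤ 1 → ∀ ε : ℝ, 0 < ε → ∃ j, ‖z - x j‖ < ε) (n : ℕ) (θ : ℝ) (hθ : 0 < θ) :
    ∃ J : Finset ℕ, ∀ z : Y, ‖z‖ ≤ 1 → ∃ j ∈ J, ∀ i < n, |F i (z - x j)| ≤ θ := by
  let T : Y →L[ℝ] (Fin n → ℝ) := ContinuousLinearMap.pi (fun i => F i)
  have hcomp : IsCompact (closure (T '' Metric.closedBall 0 1)) := by
    apply Bornology.IsBounded.isCompact_closure
    exact T.lipschitz.isBounded_image Metric.isBounded_closedBall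
  obtain ⟨J, hJ⟩ := hcomp.elim_finite_subcover (fun j : ℕ => Metric.ball (T (x j)) θ)
    (fun j => Metric.isOpen_ball) (by
      intro w hw
      obtain ⟨_, ⟨z, hz, rfl⟩, hwz⟩ := Metric.mem_closure_iff.1 hw (θ / 2) (by positivity)
      obtain ⟨j, hj⟩ := hxd z (by simpa using hz) (θ / 2 / (‖T‖ + 1)) (by positivity)
      refine Set.mem_iUnion.2 ⟨j, ?_⟩
      rw [Metric.mem_ball]
      have : dist (T z) (T (x j)) < θ / 2 := by
        rw [dist_eq_norm, ← map_sub]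
        rw [lt_div_iff₀ (by positivity)] at hj
        have := T.le_opNorm (z - x j)
        nlinarith [norm_nonneg (z - x j)]
      linarith [dist_triangle w (T z) (T (x j))])
  refine ⟨J, fun z hz => ?_⟩
  have := hJ (subset_closure ⟨z, by simpa using hz, rfl⟩)
  simp only [Set.mem_iUnion, Metric.mem_ball] at this
  obtain ⟨j, hjJ, hj⟩ := this
  refine ⟨j, hjJ, fun i hi => ?_⟩
  have h1 := (dist_le_pi_dist (T z) (T (x j)) ⟨i, hi⟩).trans hj.le
  have h2 : F i (z - x j) = T z ⟨i, hi⟩ - T (x j) ⟨i, hi⟩ := by simp [T]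
  rw [h2]
  exact h1

theorem exists_dual_P {Y : Type*} [NormedAddCommGroup Y] [NormedSpace ℝ Y]
    [TopologicalSpace.SeparableSpace Y] [TopologicalSpace.SeparableSpace (StrongDual ℝ Y)] :
    ∃ (P : StrongDual ℝ Y → ℝ) (C : ℝ), 0 < C ∧
    (∀ g, ‖g‖ ^ 2 ≤ P g) ∧ (∀ g, P g ≤ C * ‖g‖ ^ 2) ∧
    (LowerSemicontinuous (fun g : WeakDual ℝ Y => P (WeakDual.toStrongDual g))) ∧
    (∀ f : StrongDual ℝ Y, ∀ ε : ℝ, 0 < ε → ∃ η : ℝ, 0 < η ∧ ∀ g : StrongDual ℝ Y,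
      P f + P g - 2 * P ((1 / 2 : ℝ) • (f + g)) ≤ η → ‖g - f‖ ≤ ε) := by
  have := UniformSpace.secondCountable_of_separable Y
  obtain ⟨F, hF⟩ : ∃ F : ℕ → StrongDual ℝ Y, DenseRange F := ⟨_, TopologicalSpace.denseRange_denseSeq _⟩
  obtain ⟨x, hx1, hxd⟩ : ∃ x : ℕ → Y, (∀ n, ‖x n‖ ≤ 1) ∧
      ∀ z : Y, ‖z‖ ≤ 1 → ∀ ε : ℝ, 0 < ε → ∃ j, ‖z - x j‖ < ε := by
    have : Nonempty (Metric.closedBall (0 : Y) 1) := ⟨⟨0, by simp⟩⟩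
    refine ⟨fun n => (TopologicalSpace.denseSeq (Metric.closedBall (0 : Y) 1) n : Y), fun n => ?_, ?_⟩
    · exact mem_closedBall_zero_iff.1 (TopologicalSpace.denseSeq (Metric.closedBall (0 : Y) 1) n).2
    · intro z hz ε hε
      obtain ⟨j, hj⟩ := (TopologicalSpace.denseRange_denseSeq (Metric.closedBall (0 : Y) 1)).exists_dist_lt
        ⟨z, by simpa using hz⟩ hε
      exact ⟨j, by simpa [Subtype.dist_eq, dist_eq_norm] using hj⟩
  let A : ℕ → Set Y := fun n => {z | ‖z‖ ≤ 2 ∧ ∀ i < n, |F i z| ≤ 1 / ((n : ℝ) + 1)}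
  have hA0 : ∀ n, (0 : Y) ∈ A n := fun n => ⟨by simp, fun i _ => by simp; positivity⟩
  have hAneg : ∀ n z, z ∈ A n → -z ∈ A n := fun n z hz =>
    ⟨by simpa using hz.1, fun i hi => by simpa using hz.2 i hi⟩
  have : ∀ n, Nonempty (A n) := fun n => ⟨⟨0, hA0 n⟩⟩
  let q : ℕ → StrongDual ℝ Y → ℝ := fun n g => ⨆ z : A n, g z
  have hbd : ∀ n (g : StrongDual ℝ Y) (z : A n), g z ≤ 2 * ‖g‖ := by
    intro n g z
    have := (le_abs_self _).trans (g.le_opNorm z)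
    nlinarith [z.2.1, norm_nonneg g]
  have hbdd : ∀ n (g : StrongDual ℝ Y), BddAbove (Set.range fun z : A n => g z) := by
    intro n g
    refine ⟨2 * ‖g‖, ?_⟩
    rintro _ ⟨z, rfl⟩
    exact hbd n g z
  have hle : ∀ n (g : StrongDual ℝ Y) z, z ∈ A n → g z ≤ q n g := fun n g z hz =>
    le_ciSup (hbdd n g) ⟨z, hz⟩
  have habs : ∀ n (g : StrongDual ℝ Y) z, z ∈ A n → |g z| ≤ q n g := by
    intro n g z hz
    rw [abs_le]
    have := hle n g _ (hAneg n z hz)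
    rw [map_neg] at this
    exact ⟨by linarith, hle n g z hz⟩
  have hq0 : ∀ n g, 0 ≤ q n g := fun n g => by simpa using hle n g 0 (hA0 n)
  have hq2 : ∀ n g, q n g ≤ 2 * ‖g‖ := fun n g => ciSup_le (hbd n g)
  have hqm : ∀ n f g, q n ((1 / 2 : ℝ) • (f + g)) ≤ (q n f + q n g) / 2 := by
    intro n f g
    refine ciSup_le fun z => ?_
    have h1 := hle n f z z.2
    have h2 := hle n g z z.2
    simp only [smul_apply, add_apply, smul_eq_mul]
    linarith
  have hqt : ∀ g, ∀ ε : ℝ, 0 < ε → ∃ n, q n g ≤ ε := by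
    intro g ε hε
    obtain ⟨i, hi⟩ := hF.exists_dist_lt g (ε := ε / 4) (by positivity)
    obtain ⟨m, hm⟩ := exists_nat_one_div_lt (show (0 : ℝ) < ε / 2 by positivity)
    refine ⟨max (i + 1) m, ciSup_le fun z => ?_⟩
    have h1 := z.2.2 i (lt_of_lt_of_le (Nat.lt_succ_self i) (le_max_left _ _))
    have h2 : (1 : ℝ) / ((max (i + 1) m : ℕ) + 1) ≤ 1 / ((m : ℝ) + 1) := by
      apply one_div_le_one_div_of_le (by positivity)
      have : (m : ℝ) ≤ ((max (i + 1) m : ℕ) : ℝ) := by exact_mod_cast le_max_right _ _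
      linarith
    have h3 : (g - F i) z ≤ ‖g - F i‖ * ‖(z : Y)‖ := (le_abs_self _).trans ((g - F i).le_opNorm z)
    rw [dist_eq_norm] at hi
    have h4 := z.2.1
    have h5 : g z = (g - F i) z + F i z := by simp
    have h6 := le_abs_self (F i z)
    nlinarith [norm_nonneg (g - F i), norm_nonneg (z : Y)]
  let t : ℕ → StrongDual ℝ Y → ℝ := fun n g => q n g ^ 2 + (g (x n)) ^ 2
  have ht0 : ∀ n g, 0 ≤ t n g := fun n g => by positivity
  have ht5 : ∀ n g, t n g ≤ 5 * ‖g‖ ^ 2 := by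
    intro n g
    have h1 : q n g ^ 2 ≤ (2 * ‖g‖) ^ 2 := pow_le_pow_left₀ (hq0 n g) (hq2 n g) 2
    have h2 : |g (x n)| ≤ ‖g‖ := by
      have := g.le_opNorm (x n)
      rw [Real.norm_eq_abs] at this
      nlinarith [hx1 n, norm_nonneg g]
    have h3 : (g (x n)) ^ 2 ≤ ‖g‖ ^ 2 := by
      rw [← sq_abs]
      exact pow_le_pow_left₀ (abs_nonneg _) h2 2
    simp only [t]
    nlinarith
  have hsum : ∀ g, Summable (fun n => (1 / 2 : ℝ) ^ n * t n g) := by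
    intro g
    refine Summable.of_nonneg_of_le (fun n => by have := ht0 n g; positivity)
      (fun n => mul_le_mul_of_nonneg_left (ht5 n g) (by positivity))
      (summable_geometric_two.mul_right _)
  let P : StrongDual ℝ Y → ℝ := fun g => ‖g‖ ^ 2 + ∑' n, (1 / 2 : ℝ) ^ n * t n g
  have htm : ∀ n f g, (1 / 2) * (q n f - q n g) ^ 2 + (1 / 2) * ((g - f) (x n)) ^ 2 ≤
      t n f + t n g - 2 * t n ((1 / 2 : ℝ) • (f + g)) := by
    intro n f g
    simp only [t]
    have h1 := pow_le_pow_left₀ (hq0 n _) (hqm n f g) 2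
    simp only [smul_apply, add_apply, smul_eq_mul,
      sub_apply]
    nlinarith
  have hPm : ∀ n f g, (1 / 2 : ℝ) ^ n * (t n f + t n g - 2 * t n ((1 / 2 : ℝ) • (f + g))) ≤
      P f + P g - 2 * P ((1 / 2 : ℝ) • (f + g)) := by
    intro n f g
    have h1 : ‖(1 / 2 : ℝ) • (f + g)‖ ≤ (‖f‖ + ‖g‖) / 2 := by
      rw [norm_smul]
      have := norm_add_le f g
      norm_num
      linarith
    have h2 := pow_le_pow_left₀ (norm_nonneg _) h1 2
    have hs : HasSum (fun n => (1 / 2 : ℝ) ^ n * (t n f + t n g - 2 * t n ((1 / 2 : ℝ) • (f + g))))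
        ((∑' n, (1 / 2 : ℝ) ^ n * t n f) + (∑' n, (1 / 2 : ℝ) ^ n * t n g)
          - 2 * (∑' n, (1 / 2 : ℝ) ^ n * t n ((1 / 2 : ℝ) • (f + g)))) := by
      have := (((hsum f).hasSum.add (hsum g).hasSum).sub
        ((hsum ((1 / 2 : ℝ) • (f + g))).hasSum.mul_left 2))
      refine this.congr_fun ?_ |> id
      intro n
      ring
    have h3 := le_hasSum hs n (fun j _ => by
      have := htm j f g
      have : 0 ≤ t j f + t j g - 2 * t j ((1 / 2 : ℝ) • (f + g)) := by nlinarith [sq_nonneg (q j f - q j g), sq_nonneg ((g - f) (x j))]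
      positivity)
    simp only [P]
    nlinarith [sq_nonneg (‖f‖ - ‖g‖)]
  refine ⟨P, 11, by norm_num, ?_, ?_, ?_, ?_⟩
  · intro g
    have : 0 ≤ ∑' n, (1 / 2 : ℝ) ^ n * t n g := tsum_nonneg fun n => by have := ht0 n g; positivity
    simp only [P]
    linarith
  · intro g
    have : ∑' n, (1 / 2 : ℝ) ^ n * t n g ≤ ∑' n, (1 / 2 : ℝ) ^ n * (5 * ‖g‖ ^ 2) :=
      (hsum g).tsum_le_tsum (fun n => mul_le_mul_of_nonneg_left (ht5 n g) (by positivity))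
        (summable_geometric_two.mul_right _)
    rw [tsum_mul_right, tsum_geometric_two] at this
    simp only [P]
    linarith
  · apply LowerSemicontinuous.add
    · apply lsc_sq _ (fun g => norm_nonneg _)
      rw [lowerSemicontinuous_iff_isClosed_preimage]
      intro r
      have := WeakDual.isClosed_closedBall (𝕜 := ℝ) (E := Y) 0 r
      convert this using 1
      ext g
      simp
    · apply lsc_tsum
      · intro n
        have h : LowerSemicontinuous (fun g : WeakDual ℝ Y => t n (WeakDual.toStrongDual g)) := by
          apply LowerSemicontinuous.add
          · apply lsc_sq _ (fun g => hq0 _ _)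
            apply lowerSemicontinuous_ciSup
            · intro g
              exact hbdd n (WeakDual.toStrongDual g)
            · intro z
              exact (WeakDual.eval_continuous (z : Y)).lowerSemicontinuous
          · exact ((WeakDual.eval_continuous (x n)).pow 2).lowerSemicontinuous
        have hc : Continuous (fun r : ℝ => (1 / 2 : ℝ) ^ n * r) := by fun_prop
        exact hc.comp_lowerSemicontinuous h (fun a b hab => by simp only; gcongr)
      · intro n g
        have := ht0 n (WeakDual.toStrongDual g)
        positivity
      · intro g
        exact hsum _
  · intro f ε hε
    obtain ⟨n, hn⟩ := hqt f (ε / 4) (by positivity)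
    obtain ⟨J, hJ⟩ := finite_net F x hxd n (1 / ((n : ℝ) + 1)) (by positivity)
    obtain ⟨N, hN⟩ : ∃ N, n ≤ N ∧ ∀ j ∈ J, j ≤ N := by
      refine ⟨max n (J.sup id), le_max_left _ _, fun j hj => le_max_of_le_right ?_⟩
      exact Finset.le_sup (f := id) hj
    refine ⟨(1 / 2 : ℝ) ^ N * ((1 / 2) * (ε / 4) ^ 2), by positivity, fun g hg => ?_⟩
    have key : ∀ m ≤ N, (q m f - q m g) ^ 2 + ((g - f) (x m)) ^ 2 ≤ (ε / 4) ^ 2 := by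
      intro m hm
      have h1 := (hPm m f g).trans hg
      have h2 : (1 / 2 : ℝ) ^ N ≤ (1 / 2 : ℝ) ^ m := pow_le_pow_of_le_one (by norm_num) (by norm_num) hm
      have h3 := htm m f g
      have h4 : (1 / 2 : ℝ) ^ m * (t m f + t m g - 2 * t m ((1 / 2 : ℝ) • (f + g))) ≤
          (1 / 2 : ℝ) ^ m * ((1 / 2) * (ε / 4) ^ 2) := h1.trans (by gcongr)
      have h5 := le_of_mul_le_mul_left h4 (by positivity)
      linarith
    have kq : |q n f - q n g| ≤ ε / 4 := by
      apply abs_le_of_sq_le_sq _ (by positivity)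
      have := key n hN.1
      nlinarith [sq_nonneg ((g - f) (x n))]
    have kx : ∀ j ∈ J, |(g - f) (x j)| ≤ ε / 4 := by
      intro j hj
      apply abs_le_of_sq_le_sq _ (by positivity)
      have := key j (hN.2 j hj)
      nlinarith [sq_nonneg (q j f - q j g)]
    have hball : ∀ z : Y, ‖z‖ ≤ 1 → |(g - f) z| ≤ ε := by
      intro z hz
      obtain ⟨j, hj, hij⟩ := hJ z hz
      have hmem : z - x j ∈ A n := by
        refine ⟨?_, hij⟩
        have := norm_sub_le z (x j)
        linarith [hx1 j]
      have h1 := habs n f _ hmem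
      have h2 := habs n g _ hmem
      have h3 := kx j hj
      have h4 : (g - f) z = (g - f) (x j) + g (z - x j) - f (z - x j) := by
        simp only [sub_apply, map_sub]
        ring
      rw [h4]
      rw [abs_le] at *
      constructor <;> linarith
    apply ContinuousLinearMap.opNorm_le_of_unit_norm hε.le
    intro z hz
    exact hball z hz.le


theorem smooth_vp {Z : Type*} [MetricSpace Z] [CompleteSpace Z] (D : Set Z) (f : Z → ℝ)
    (hepi : ∀ (u : ℕ → Z) (r : ℕ → ℝ) (x : Z) (s : ℝ), (∀ n, u n ∈ D ∧ f (u n) ≤ r n) →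
      Tendsto u atTop (𝓝 x) → Tendsto r atTop (𝓝 s) → x ∈ D ∧ f x ≤ s)
    (M : ℝ) (hM : ∀ x ∈ D, M ≤ f x) (ρ : Z → Z → ℝ) (hρc : ∀ y, Continuous (fun x => ρ x y))
    (hρ0 : ∀ x y, 0 ≤ ρ x y) (hρs : ∀ x, ρ x x = 0) (C : ℝ) (hC : 0 < C)
    (hρd : ∀ x y, dist x y ^ 2 ≤ C * ρ x y) (R : ℝ) (hR : ∀ x ∈ D, ∀ y ∈ D, ρ x y ≤ R)
    (z0 : Z) (hz0 : z0 ∈ D) (δ : ℝ) (hδ : 0 < δ) :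
    ∃ (z : ℕ → Z) (v : Z), (∀ n, z n ∈ D) ∧ v ∈ D ∧ f v ≤ f z0 ∧
      ∀ x ∈ D, f v + ∑' i, δ * (1 / 2) ^ i * ρ v (z i) ≤ f x + ∑' i, δ * (1 / 2) ^ i * ρ x (z i) := by
  let δs : ℕ → ℝ := fun i => δ * (1 / 2) ^ i
  have hδs : ∀ i, 0 < δs i := fun i => by positivity
  let η : ℕ → ℝ := fun i => δs i * (1 / 4) ^ i
  have hη : ∀ i, 0 < η i := fun i => by have := hδs i; positivity
  have hsel : ∀ (n : ℕ) (g : Z → ℝ) (y : Z), ∃ x, (y ∈ D ∧ ∀ w ∈ D, M ≤ g w) →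
      x ∈ D ∧ g x ≤ g y ∧ ∀ w ∈ D, g x ≤ g w + η n := by
    intro n g y
    by_cases h : y ∈ D ∧ ∀ w ∈ D, M ≤ g w
    · obtain ⟨hy, hg⟩ := h
      have hbdd : BddBelow (g '' D) := ⟨M, by rintro _ ⟨w, hw, rfl⟩; exact hg w hw⟩
      obtain ⟨_, ⟨x, hx, rfl⟩, hlt⟩ := exists_lt_of_csInf_lt (s := g '' D) ⟨_, ⟨y, hy, rfl⟩⟩
        (lt_add_of_pos_right (sInf (g '' D)) (hη n))
      rcases le_total (g x) (g y) with hxy | hxy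
      · refine ⟨x, fun _ => ⟨hx, hxy, fun w hw => ?_⟩⟩
        have := csInf_le hbdd ⟨w, hw, rfl⟩
        linarith
      · refine ⟨y, fun _ => ⟨hy, le_rfl, fun w hw => ?_⟩⟩
        have := csInf_le hbdd ⟨w, hw, rfl⟩
        linarith
    · exact ⟨y, fun h' => absurd h' h⟩
  choose sel hsel using hsel
  let st : ℕ → Z × (Z → ℝ) := fun n => Nat.rec (sel 0 f z0, f)
    (fun n s => (sel (n + 1) (fun w => s.2 w + δs n * ρ w s.1) s.1,
      fun w => s.2 w + δs n * ρ w s.1)) n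
  let x : ℕ → Z := fun n => (st n).1
  let g : ℕ → Z → ℝ := fun n => (st n).2
  have hg0 : g 0 = f := rfl
  have hx0 : x 0 = sel 0 f z0 := rfl
  have hgs : ∀ n w, g (n + 1) w = g n w + δs n * ρ w (x n) := fun n w => rfl
  have hxs : ∀ n, x (n + 1) = sel (n + 1) (g (n + 1)) (x n) := fun n => rfl
  have hgM : ∀ n, ∀ w ∈ D, M ≤ g n w := by
    intro n
    induction n with
    | zero => exact hM
    | succ n ih =>
      intro w hw
      rw [hgs]
      have := ih w hw
      have := mul_nonneg (hδs n).le (hρ0 w (x n))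
      linarith
  have hxD : ∀ n, x n ∈ D := by
    intro n
    induction n with
    | zero => exact (hsel 0 f z0 ⟨hz0, hM⟩).1
    | succ n ih => rw [hxs]; exact (hsel (n + 1) (g (n + 1)) (x n) ⟨ih, hgM (n + 1)⟩).1
  have hxmin : ∀ n, ∀ w ∈ D, g n (x n) ≤ g n w + η n := by
    intro n
    cases n with
    | zero => exact (hsel 0 f z0 ⟨hz0, hM⟩).2.2
    | succ n => rw [hxs]; exact (hsel (n + 1) (g (n + 1)) (x n) ⟨hxD n, hgM (n + 1)⟩).2.2
  have hdec : ∀ n, g (n + 1) (x (n + 1)) ≤ g n (x n) := by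
    intro n
    have h := (hsel (n + 1) (g (n + 1)) (x n) ⟨hxD n, hgM (n + 1)⟩).2.1
    rw [← hxs] at h
    have h2 := hgs n (x n)
    rw [hρs, mul_zero, add_zero] at h2
    linarith
  have hanti : Antitone (fun n => g n (x n)) := antitone_nat_of_succ_le hdec
  have hgmono : ∀ w, Monotone (fun n => g n w) := fun w => monotone_nat_of_le_succ fun n => by
    have := mul_nonneg (hδs n).le (hρ0 w (x n))
    simp only [hgs]
    linarith
  have hgsum : ∀ n w, g n w = f w + ∑ i ∈ Finset.range n, δs i * ρ w (x i) := by
    intro n w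
    induction n with
    | zero => simp [hg0]
    | succ n ih => rw [hgs, ih, Finset.sum_range_succ]; ring
  have hdist : ∀ n, dist (x n) (x (n + 1)) ≤ Real.sqrt C * (1 / 2) ^ n := by
    intro n
    have h1 := hdec n
    rw [hgs] at h1
    have h2 := hxmin n _ (hxD (n + 1))
    have h3 : δs n * ρ (x (n + 1)) (x n) ≤ δs n * (1 / 4) ^ n := by
      have : η n = δs n * (1 / 4) ^ n := rfl
      linarith
    have h4 := le_of_mul_le_mul_left h3 (hδs n)
    have h5 := hρd (x (n + 1)) (x n)
    rw [dist_comm]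
    refine (sq_le_sq₀ dist_nonneg (by positivity)).1 ?_
    rw [mul_pow, Real.sq_sqrt hC.le, ← pow_mul, mul_comm n 2, pow_mul]
    norm_num at h4 ⊢
    nlinarith
  obtain ⟨v, hv⟩ := cauchySeq_tendsto_of_complete (cauchySeq_of_le_geometric _ _ (by norm_num) hdist)
  have hvn : ∀ n, v ∈ D ∧ f v ≤ g n (x n) - ∑ i ∈ Finset.range (n + 1), δs i * ρ v (x i) := by
    intro n
    apply hepi (fun m => x (m + (n + 1)))
      (fun m => g n (x n) - ∑ i ∈ Finset.range (n + 1), δs i * ρ (x (m + (n + 1))) (x i))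
    · intro m
      refine ⟨hxD (m + (n + 1)), ?_⟩
      have h1 := hgsum (n + 1) (x (m + (n + 1)))
      have h2 := hgmono (x (m + (n + 1))) (show n + 1 ≤ m + (n + 1) by omega)
      have h3 := hanti (show n ≤ m + (n + 1) by omega)
      simp only at h2 h3
      linarith
    · exact (tendsto_add_atTop_iff_nat (n + 1)).2 hv
    · have hc : Continuous (fun w => g n (x n) - ∑ i ∈ Finset.range (n + 1), δs i * ρ w (x i)) := by
        have := fun i => hρc (x i)
        fun_prop
      exact (hc.tendsto v).comp ((tendsto_add_atTop_iff_nat (n + 1)).2 hv)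
  have hvD := (hvn 0).1
  have hsummable : ∀ w ∈ D, Summable (fun i => δs i * ρ w (x i)) := by
    intro w hw
    refine Summable.of_nonneg_of_le (fun i => mul_nonneg (hδs i).le (hρ0 _ _))
      (fun i => mul_le_mul_of_nonneg_left (hR w hw _ (hxD i)) (hδs i).le) ?_
    exact (summable_geometric_two.mul_left δ).mul_right R
  refine ⟨x, v, hxD, hvD, ?_, ?_⟩
  · have h1 := (hvn 0).2
    have h2 : g 0 (x 0) ≤ f z0 := (hsel 0 f z0 ⟨hz0, hM⟩).2.1
    have h3 : 0 ≤ ∑ i ∈ Finset.range (0 + 1), δs i * ρ v (x i) :=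
      Finset.sum_nonneg fun i _ => mul_nonneg (hδs i).le (hρ0 _ _)
    linarith
  · intro w hw
    have hηt : Tendsto η atTop (𝓝 0) := by
      have : η = fun i => δ * (1 / 8) ^ i := by
        funext i
        simp only [η, δs]
        rw [mul_assoc, ← mul_pow]
        norm_num
      rw [this]
      simpa using (tendsto_pow_atTop_nhds_zero_of_lt_one (show (0 : ℝ) ≤ 1 / 8 by norm_num)
        (by norm_num)).const_mul δ
    have hlim1 : Tendsto (fun n => f v + ∑ i ∈ Finset.range (n + 1), δs i * ρ v (x i)) atTop
        (𝓝 (f v + ∑' i, δs i * ρ v (x i))) :=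
      ((tendsto_add_atTop_iff_nat 1).2 (hsummable v hvD).hasSum.tendsto_sum_nat).const_add _
    have hlim2 : Tendsto (fun n => f w + ∑' i, δs i * ρ w (x i) + η n) atTop
        (𝓝 (f w + ∑' i, δs i * ρ w (x i) + 0)) := hηt.const_add _
    rw [add_zero] at hlim2
    refine le_of_tendsto_of_tendsto' hlim1 hlim2 fun n => ?_
    have h1 := (hvn n).2
    have h2 := hxmin n w hw
    rw [hgsum n w] at h2
    have h3 := (hsummable w hw).sum_le_tsum (Finset.range n)
      (fun i _ => mul_nonneg (hδs i).le (hρ0 _ _))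
    linarith


theorem lsc_epi {Y : Type*} [TopologicalSpace Y] (φ : Y → EReal) (hlsc : LowerSemicontinuous φ)
    (y : ℕ → Y) (e : ℕ → ℝ) (y0 : Y) (e0 : ℝ) (h : ∀ n, φ (y n) ≤ (e n : EReal))
    (hy : Tendsto y atTop (𝓝 y0)) (he : Tendsto e atTop (𝓝 e0)) : φ y0 ≤ (e0 : EReal) := by
  by_contra hc
  push Not at hc
  obtain ⟨e', h1, h2⟩ := EReal.lt_iff_exists_real_btwn.1 hc
  have h1' : e0 < e' := by exact_mod_cast h1
  obtain ⟨n, hn1, hn2⟩ := ((hy.eventually (hlsc y0 _ h2)).and (he.eventually (gt_mem_nhds h1'))).exists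
  have h3 : (e' : EReal) < (e n : EReal) := hn1.trans_le (h n)
  have h4 : e' < e n := by exact_mod_cast h3
  linarith

theorem mvt_of_smooth {Y : Type*} [NormedAddCommGroup Y] [NormedSpace ℝ Y] [CompleteSpace Y]
    (Q : Y → ℝ) (D : Y → StrongDual ℝ Y) (C : ℝ) (hC : 0 < C) (hQ0 : Q 0 = 0)
    (hQl : ∀ x, ‖x‖ ^ 2 ≤ C * Q x) (hQu : ∀ x, Q x ≤ ‖x‖ ^ 2)
    (hQd : ∀ x, HasFDerivAt Q (D x) x) (hDn : ∀ x, ‖D x‖ ≤ ‖x‖) (hDp : ∀ x, 0 ≤ D x x)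
    (φ : Y → EReal) (hnobot : ∀ x, φ x ≠ ⊥) (hlsc : LowerSemicontinuous φ)
    (a b : Y) (s : ℝ) (hs : 0 < s) (hab : φ a < φ b) (ε : ℝ) (hε : 0 < ε) :
    ∃ t : ℝ, 0 ≤ t ∧ t < 1 ∧ ∃ u : Y, ‖u - (a + t • (b - a))‖ < ε ∧
      ∃ us ∈ FrechetSubdiff φ u, 0 < us (b + s • (b - a) - u) := by
  have hQc : Continuous Q := continuous_iff_continuousAt.2 fun x => (hQd x).continuousAt
  have hQnn : ∀ x, 0 ≤ Q x := fun x => by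
    have := (sq_nonneg ‖x‖).trans (hQl x)
    exact nonneg_of_mul_nonneg_right this hC
  let σ : ℝ → Y := fun t => a + t • (b - a)
  have hσc : Continuous σ := by fun_prop
  have hσ0 : σ 0 = a := by simp [σ]
  have hσ1 : σ 1 = b := by simp [σ]
  let S : Set Y := σ '' Set.Icc 0 1
  have hS : IsCompact S := isCompact_Icc.image hσc
  have hmemS : ∀ t, 0 ≤ t → t ≤ 1 → σ t ∈ S := fun t h0 h1 => ⟨t, ⟨h0, h1⟩, rfl⟩
  have haS : a ∈ S := hσ0 ▸ hmemS 0 le_rfl zero_le_one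
  -- lower bound
  obtain ⟨x0, hx0S, hx0⟩ := LowerSemicontinuousOn.exists_isMinOn ⟨a, haS⟩ hS (hlsc.lowerSemicontinuousOn S)
  obtain ⟨M, -, hM⟩ := EReal.lt_iff_exists_real_btwn.1 (bot_lt_iff_ne_bot.2 (hnobot x0))
  obtain ⟨ρ1, hρ1, hρ1S⟩ := hS.exists_cthickening_subset_open (hlsc.isOpen_preimage (M : EReal))
    (fun y hy => hM.trans_le (hx0 hy))
  have hatop : φ a ≠ ⊤ := ne_top_of_lt hab
  let F : Y → ℝ := fun y => (φ y).toReal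
  have hF : ∀ y, φ y ≠ ⊤ → φ y = (F y : EReal) := fun y hy => (EReal.coe_toReal hy (hnobot y)).symm
  obtain ⟨r, hr1, hr2⟩ := EReal.lt_iff_exists_real_btwn.1 hab
  have hAr : F a < r := by
    rw [hF a hatop] at hr1
    exact_mod_cast hr1
  have hMA : M < F a := by
    have : (M : EReal) < φ a := hM.trans_le (hx0 haS)
    rw [hF a hatop] at this
    exact_mod_cast this
  obtain ⟨ρ2, hρ2, hρ2b⟩ := Metric.isOpen_iff.1 (hlsc.isOpen_preimage (r : EReal)) b hr2
  obtain ⟨ρ0, hρ0, h01, h02, h03⟩ : ∃ ρ0 : ℝ, 0 < ρ0 ∧ ρ0 ≤ ρ1 ∧ ρ0 ≤ ρ2 ∧ ρ0 ≤ ε :=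
    ⟨min ρ1 (min ρ2 ε), by positivity, min_le_left _ _, (min_le_right _ _).trans (min_le_left _ _),
      (min_le_right _ _).trans (min_le_right _ _)⟩
  obtain ⟨lam, hlam, hlamr⟩ : ∃ lam : ℝ, 0 < lam ∧ F a < r - lam := ⟨(r - F a) / 2, by linarith, by linarith⟩
  obtain ⟨K, hK, hKl⟩ : ∃ K : ℝ, 0 < K ∧ F a < M - lam + K * (ρ0 ^ 2 / C) := by
    refine ⟨(F a - M + lam + 1) / (ρ0 ^ 2 / C), by have : 0 < F a - M + lam + 1 := by linarith
                                                   positivity, ?_⟩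
    rw [div_mul_cancel₀ _ (by positivity)]
    linarith
  let Dm : Set (Y × ℝ) := {p | 0 ≤ p.2 ∧ p.2 ≤ 1 ∧ ‖p.1 - σ p.2‖ ≤ ρ0 ∧ φ p.1 ≠ ⊤}
  let H : Y × ℝ → ℝ := fun p => F p.1 - lam * p.2 + K * Q (p.1 - σ p.2)
  have hMD : ∀ p ∈ Dm, M < F p.1 := by
    rintro ⟨u, t⟩ ⟨h0, h1, h2, h3⟩
    have : (M : EReal) < φ u := hρ1S (Metric.mem_cthickening_of_dist_le u (σ t) ρ1 S (hmemS t h0 h1)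
      (by rw [dist_eq_norm]; exact h2.trans h01))
    rw [hF u h3] at this
    exact_mod_cast this
  let B : ℝ := ρ0 + ‖b - a‖
  have hB : 0 < B := by positivity
  have hBD : ∀ p ∈ Dm, ‖p.1 - a‖ ≤ B := by
    rintro ⟨u, t⟩ ⟨h0, h1, h2, h3⟩
    have e1 : u - a = (u - σ t) + t • (b - a) := by simp only [σ]; abel
    have e2 : ‖t • (b - a)‖ ≤ ‖b - a‖ := by
      rw [norm_smul, Real.norm_of_nonneg h0]
      exact mul_le_of_le_one_left (norm_nonneg _) h1
    simp only at *
    rw [e1]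
    exact (norm_add_le _ _).trans (add_le_add h2 e2)
  have hBB : ∀ p ∈ Dm, ∀ p' ∈ Dm, ‖p.1 - p'.1‖ ≤ 2 * B := by
    intro p hp p' hp'
    have e1 : p.1 - p'.1 = (p.1 - a) - (p'.1 - a) := by abel
    rw [e1]
    have := norm_sub_le (p.1 - a) (p'.1 - a)
    linarith [hBD p hp, hBD p' hp']
  let c : Y := b + s • (b - a)
  let R2 : ℝ := ‖c - a‖ + B
  have hR2 : 0 < R2 := by positivity
  obtain ⟨δ, hδ, hδs⟩ : ∃ δ : ℝ, 0 < δ ∧ 0 < s * (lam - 4 * δ) - 4 * B * δ * R2 := by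
    refine ⟨s * lam / (2 * (4 * s + 4 * B * R2)), by positivity, ?_⟩
    have e1 : s * (lam - 4 * (s * lam / (2 * (4 * s + 4 * B * R2)))) -
      4 * B * (s * lam / (2 * (4 * s + 4 * B * R2))) * R2 = s * lam / 2 := by
      field_simp
      ring
    rw [e1]
    positivity
  have hδ4 : 0 < lam - 4 * δ := by
    have : 0 < s * (lam - 4 * δ) := by
      have : 0 < 4 * B * δ * R2 := by positivity
      linarith
    exact pos_of_mul_pos_right this hs.le
  obtain ⟨z, ⟨u, t⟩, hzD, hvD, hvz, hmin⟩ := smooth_vp Dm H (by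
      intro w r' p s' hw hwp hr'
      have hw1 : Tendsto (fun n => (w n).1) atTop (𝓝 p.1) := (continuous_fst.tendsto p).comp hwp
      have hw2 : Tendsto (fun n => (w n).2) atTop (𝓝 p.2) := (continuous_snd.tendsto p).comp hwp
      have hcl : IsClosed {p : Y × ℝ | 0 ≤ p.2 ∧ p.2 ≤ 1 ∧ ‖p.1 - σ p.2‖ ≤ ρ0} := by
        refine (isClosed_le continuous_const continuous_snd).inter
          ((isClosed_le continuous_snd continuous_const).inter
            (isClosed_le (f := fun p : Y × ℝ => ‖p.1 - σ p.2‖) (by fun_prop) continuous_const))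
      have hp := hcl.mem_of_tendsto hwp (Eventually.of_forall fun n =>
        ⟨(hw n).1.1, (hw n).1.2.1, (hw n).1.2.2.1⟩)
      have hcont : Continuous (fun p : Y × ℝ => lam * p.2 - K * Q (p.1 - σ p.2)) := by fun_prop
      have hle := lsc_epi φ hlsc (fun n => (w n).1)
        (fun n => r' n + (lam * (w n).2 - K * Q ((w n).1 - σ (w n).2))) p.1
        (s' + (lam * p.2 - K * Q (p.1 - σ p.2))) (by
          intro n
          rw [hF _ (hw n).1.2.2.2]
          have := (hw n).2
          simp only [H] at this
          exact_mod_cast (by linarith)) hw1 (hr'.add ((hcont.tendsto p).comp hwp))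
      have hpt : φ p.1 ≠ ⊤ := ne_top_of_le_ne_top (EReal.coe_ne_top _) hle
      refine ⟨⟨hp.1, hp.2.1, hp.2.2, hpt⟩, ?_⟩
      rw [hF _ hpt] at hle
      have : F p.1 ≤ s' + (lam * p.2 - K * Q (p.1 - σ p.2)) := by exact_mod_cast hle
      simp only [H]
      linarith) (M - lam) (by
      intro p hp
      have h1 := hMD p hp
      have h2 := mul_nonneg hK.le (hQnn (p.1 - σ p.2))
      have h3 := hp.2.1
      simp only [H]
      nlinarith) (fun p p' => Q (p.1 - p'.1) + (p.2 - p'.2) ^ 2) (fun p' => by fun_prop)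
    (fun p p' => add_nonneg (hQnn _) (sq_nonneg _)) (fun p => by simp [hQ0]) (max C 1)
    (by positivity) (by
      intro p p'
      rw [Prod.dist_eq, dist_eq_norm, Real.dist_eq]
      have h1 := hQl (p.1 - p'.1)
      have h2 : C * Q (p.1 - p'.1) ≤ max C 1 * Q (p.1 - p'.1) :=
        mul_le_mul_of_nonneg_right (le_max_left _ _) (hQnn _)
      have h3 : 1 * (p.2 - p'.2) ^ 2 ≤ max C 1 * (p.2 - p'.2) ^ 2 :=
        mul_le_mul_of_nonneg_right (le_max_right _ _) (sq_nonneg _)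
      have h4 := mul_nonneg hC.le (hQnn (p.1 - p'.1))
      rcases max_choice ‖p.1 - p'.1‖ |p.2 - p'.2| with h | h
      · rw [h]
        nlinarith [sq_nonneg (p.2 - p'.2)]
      · rw [h, sq_abs]
        nlinarith [sq_nonneg (p.2 - p'.2)]) ((2 * B) ^ 2 + 1) (by
      intro p hp p' hp'
      have h1 := hQu (p.1 - p'.1)
      have h2 := pow_le_pow_left₀ (norm_nonneg _) (hBB p hp p' hp') 2
      have h3 : (p.2 - p'.2) ^ 2 ≤ 1 := by
        rw [sq_le_one_iff_abs_le_one, abs_le]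
        constructor <;> linarith [hp.1, hp.2.1, hp'.1, hp'.2.1]
      linarith) (a, 0) ⟨le_rfl, zero_le_one, by simpa [hσ0] using hρ0.le, hatop⟩ δ hδ
  obtain ⟨ht0, ht1, hut, huT⟩ := hvD
  simp only at ht0 ht1 hut huT
  have hvz' : F u - lam * t + K * Q (u - σ t) ≤ F a := by
    simpa [H, hσ0, hQ0] using hvz
  have hut' : ‖u - σ t‖ < ρ0 := by
    refine lt_of_le_of_ne hut fun heq => ?_
    have h1 := hQl (u - σ t)
    rw [heq] at h1
    have h2 : ρ0 ^ 2 / C ≤ Q (u - σ t) := by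
      rw [div_le_iff₀ hC]
      linarith
    have h3 := mul_le_mul_of_nonneg_left h2 hK.le
    have h4 := hMD (u, t) ⟨ht0, ht1, hut, huT⟩
    simp only at h4
    nlinarith
  have ht1' : t < 1 := by
    refine lt_of_le_of_ne ht1 fun heq => ?_
    subst heq
    rw [hσ1] at hut' hvz'
    have h1 : (r : EReal) < φ u := hρ2b (by rw [Metric.mem_ball, dist_eq_norm]; linarith)
    rw [hF u huT] at h1
    have h2 : r < F u := by exact_mod_cast h1
    have := mul_nonneg hK.le (hQnn (u - b))
    linarith
  -- splitting of the perturbation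
  have hzu : ∀ i, ‖u - (z i).1‖ ≤ 2 * B := fun i => hBB (u, t) ⟨ht0, ht1, hut, huT⟩ _ (hzD i)
  have hsum1 : ∀ y : Y, Summable (fun i => δ * (1 / 2) ^ i * Q (y - (z i).1)) := by
    intro y
    refine Summable.of_nonneg_of_le (fun i => mul_nonneg (by positivity) (hQnn _))
      (fun i => mul_le_mul_of_nonneg_left ((hQu _).trans (pow_le_pow_left₀ (norm_nonneg _)
        (show ‖y - (z i).1‖ ≤ ‖y - u‖ + 2 * B from ?_) 2)) (by positivity))
      ((summable_geometric_two.mul_left δ).mul_right _)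
    have e1 : y - (z i).1 = (y - u) + (u - (z i).1) := by abel
    rw [e1]
    exact (norm_add_le _ _).trans (by linarith [hzu i])
  have hsum2 : ∀ t' : ℝ, 0 ≤ t' → t' ≤ 1 → Summable (fun i => δ * (1 / 2) ^ i * (t' - (z i).2) ^ 2) := by
    intro t' h0 h1
    refine Summable.of_nonneg_of_le (fun i => by positivity)
      (fun i => mul_le_mul_of_nonneg_left (show (t' - (z i).2) ^ 2 ≤ 1 from ?_) (by positivity))
      ((summable_geometric_two.mul_left δ).mul_right _)
    rw [sq_le_one_iff_abs_le_one, abs_le]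
    have h2 := (hzD i).1
    have h3 := (hzD i).2.1
    constructor <;> linarith
  let Θ : Y → ℝ := fun y => ∑' i, δ * (1 / 2) ^ i * Q (y - (z i).1)
  let Ψ : ℝ → ℝ := fun t' => ∑' i, δ * (1 / 2) ^ i * (t' - (z i).2) ^ 2
  have hsplit : ∀ y t', 0 ≤ t' → t' ≤ 1 →
      ∑' i, δ * (1 / 2) ^ i * (Q (y - (z i).1) + (t' - (z i).2) ^ 2) = Θ y + Ψ t' := by
    intro y t' h0 h1
    simp only [mul_add]
    exact (hsum1 y).tsum_add (hsum2 t' h0 h1)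
  have hmin' : ∀ y t', 0 ≤ t' → t' ≤ 1 → ‖y - σ t'‖ ≤ ρ0 → φ y ≠ ⊤ →
      F u - lam * t + K * Q (u - σ t) + (Θ u + Ψ t) ≤
        F y - lam * t' + K * Q (y - σ t') + (Θ y + Ψ t') := by
    intro y t' h0 h1 h2 h3
    have := hmin (y, t') ⟨h0, h1, h2, h3⟩
    simp only [H] at this
    rwa [hsplit _ _ ht0 ht1, hsplit _ _ h0 h1] at this
  -- derivative of Θ
  let L : StrongDual ℝ Y := ∑' i, (δ * (1 / 2) ^ i) • D (u - (z i).1)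
  have hΘ : HasFDerivAt Θ L u := by
    refine hasFDerivAt_tsum_of_isPreconnected (u := fun i => δ * (1 / 2) ^ i * (1 + 2 * B))
      (f := fun i y => δ * (1 / 2) ^ i * Q (y - (z i).1))
      (f' := fun i y => (δ * (1 / 2) ^ i) • D (y - (z i).1))
      (s := Metric.ball u 1) (x₀ := u)
      ((summable_geometric_two.mul_left δ).mul_right _) Metric.isOpen_ball
      (convex_ball u 1).isPreconnected ?_ ?_ (Metric.mem_ball_self one_pos) (hsum1 u)
      (Metric.mem_ball_self one_pos)
    · intro i y _
      have h1 : HasFDerivAt (fun y => Q (y - (z i).1)) (D (y - (z i).1)) y := by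
        have := (hQd (y - (z i).1)).comp y ((hasFDerivAt_id y).sub_const (z i).1)
        rw [ContinuousLinearMap.comp_id] at this
        exact this
      exact h1.const_mul _
    · intro i y hy
      rw [norm_smul, Real.norm_of_nonneg (by positivity)]
      refine mul_le_mul_of_nonneg_left ((hDn _).trans ?_) (by positivity)
      have e1 : y - (z i).1 = (y - u) + (u - (z i).1) := by abel
      rw [e1]
      rw [Metric.mem_ball, dist_eq_norm] at hy
      exact (norm_add_le _ _).trans (by linarith [hzu i])
  have hL : ‖L‖ ≤ 4 * B * δ := by
    have h1 : HasSum (fun i => δ * (1 / 2) ^ i * (2 * B)) (δ * 2 * (2 * B)) :=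
      (hasSum_geometric_two.mul_left δ).mul_right _
    have := tsum_of_norm_bounded (f := fun i => (δ * (1 / 2) ^ i) • D (u - (z i).1)) h1 (fun i => by
      rw [norm_smul, Real.norm_of_nonneg (by positivity)]
      exact mul_le_mul_of_nonneg_left ((hDn _).trans (hzu i)) (by positivity))
    calc ‖L‖ ≤ _ := this
      _ = _ := by ring
  have hΨ : ∀ t', t ≤ t' → t' ≤ 1 → Ψ t' ≤ Ψ t + 4 * δ * (t' - t) := by
    intro t' h1 h2
    have h3 : HasSum (fun i => δ * (1 / 2) ^ i * (t - (z i).2) ^ 2 + δ * (1 / 2) ^ i * (2 * (t' - t)))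
        (Ψ t + δ * 2 * (2 * (t' - t))) :=
      (hsum2 t ht0 ht1).hasSum.add ((hasSum_geometric_two.mul_left δ).mul_right _)
    have h4 := hasSum_le (fun i => ?_) (hsum2 t' (ht0.trans h1) h2).hasSum h3
    · calc Ψ t' ≤ _ := h4
        _ = _ := by ring
    · rw [← mul_add]
      refine mul_le_mul_of_nonneg_left ?_ (by positivity)
      have h5 := (hzD i).1
      have h6 := (hzD i).2.1
      nlinarith
  let g : StrongDual ℝ Y := D (u - σ t)
  have hGd : HasFDerivAt (fun y => K * Q (y - σ t) + Θ y) (K • g + L) u := by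
    have h1 : HasFDerivAt (fun y => Q (y - σ t)) (D (u - σ t)) u := by
      have := (hQd (u - σ t)).comp u ((hasFDerivAt_id u).sub_const (σ t))
      rw [ContinuousLinearMap.comp_id] at this
      exact this
    exact (h1.const_mul K).add hΘ
  have hsub : -(K • g + L) ∈ FrechetSubdiff φ u := by
    refine ⟨huT, fun ε' hε' => ?_⟩
    rw [hasFDerivAt_iff_isLittleO, Asymptotics.isLittleO_iff] at hGd
    have hnear : ∀ᶠ y in 𝓝 u, ‖y - σ t‖ < ρ0 := by
      have hc : Continuous (fun y => ‖y - σ t‖) := by fun_prop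
      exact (hc.tendsto u).eventually (gt_mem_nhds hut')
    filter_upwards [hGd hε', hnear] with y hy1 hy2
    by_cases hyT : φ y = ⊤
    · rw [hyT]; exact le_top
    · have h1 := hmin' y t ht0 ht1 hy2.le hyT
      rw [Real.norm_eq_abs, abs_le] at hy1
      rw [hF u huT, hF y hyT]
      have h2 : F u + (-(K • g + L)) (y - u) - ε' * ‖y - u‖ ≤ F y := by
        have e : (-(K • g + L)) (y - u) = -((K • g + L) (y - u)) := rfl
        rw [e]
        linarith
      exact_mod_cast h2
  -- derivative in t
  have htd : lam - 4 * δ ≤ -(K * g (b - a)) := by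
    let k : ℝ → ℝ := fun t' => (4 * δ - lam) * t' + K * Q (u - σ t')
    have hkd : HasDerivAt k ((4 * δ - lam) * 1 + K * g (-(b - a))) t := by
      have h0 : HasDerivAt (fun t' => u - σ t') (-(b - a)) t := by
        have := (((hasDerivAt_id t).smul_const (b - a)).const_add a).const_sub u
        simpa using this
      have h1 : HasDerivAt (fun t' => Q (u - σ t')) (g (-(b - a))) t :=
        (hQd (u - σ t)).comp_hasDerivAt t h0
      exact ((hasDerivAt_id t).const_mul _).add (h1.const_mul K)
    have hslope : Tendsto (slope k t) (𝓝[>] t) (𝓝 ((4 * δ - lam) * 1 + K * g (-(b - a)))) :=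
      (hasDerivAt_iff_tendsto_slope.1 hkd).mono_left (nhdsWithin_mono _ fun x hx => ne_of_gt hx)
    have hnear : ∀ᶠ t' in 𝓝 t, ‖u - σ t'‖ < ρ0 := by
      have hc : Continuous (fun t' => ‖u - σ t'‖) := by fun_prop
      exact (hc.tendsto t).eventually (gt_mem_nhds hut')
    have h0 : 0 ≤ (4 * δ - lam) * 1 + K * g (-(b - a)) := by
      refine ge_of_tendsto hslope ?_
      filter_upwards [self_mem_nhdsWithin, nhdsWithin_le_nhds hnear,
        nhdsWithin_le_nhds (gt_mem_nhds ht1')] with t' h1 h2 h3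
      have h1' : t < t' := h1
      rw [slope_def_field]
      refine div_nonneg ?_ (by linarith)
      have h4 := hmin' u t' (by linarith) h3.le h2.le huT
      have h5 := hΨ t' h1'.le h3.le
      simp only [k]
      linarith
    rw [map_neg] at h0
    linarith
  refine ⟨t, ht0, ht1', u, hut'.trans_le h03, _, hsub, ?_⟩
  change 0 < (-(K • g + L)) (c - u)
  have e1 : c - u = (1 - t + s) • (b - a) - (u - σ t) := by
    simp only [c, σ]
    module
  have e2 : (-(K • g + L)) (c - u) = (1 - t + s) * (-(K * g (b - a))) + K * g (u - σ t) - L (c - u) := by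
    have : g (c - u) = (1 - t + s) * g (b - a) - g (u - σ t) := by
      rw [e1, map_sub, map_smul, smul_eq_mul]
    have e : (-(K • g + L)) (c - u) = -(K * g (c - u) + L (c - u)) := rfl
    rw [e, this]
    ring
  rw [e2]
  have h1 : L (c - u) ≤ 4 * B * δ * R2 := by
    refine ((le_abs_self _).trans (L.le_opNorm _)).trans ?_
    refine mul_le_mul hL ?_ (norm_nonneg _) (by positivity)
    have : c - u = (c - a) - (u - a) := by abel
    rw [this]
    exact (norm_sub_le _ _).trans (add_le_add le_rfl (hBD (u, t) ⟨ht0, ht1, hut, huT⟩))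
  have h2 : 0 ≤ K * g (u - σ t) := mul_nonneg hK.le (hDp _)
  have h3 : s * (lam - 4 * δ) ≤ (1 - t + s) * (-(K * g (b - a))) :=
    mul_le_mul (by linarith) htd hδ4.le (by linarith)
  linarith


/-- A functional satisfying finitely or infinitely many of the subgradient inequalities. -/
def GoodAt {X : Type*} [NormedAddCommGroup X] [NormedSpace ℝ X] (φ : X → EReal) (c : X)
    (κ q : ℝ) (J : Set (ℕ × ℕ)) (V : Set X) (u : X) : Prop :=
  ∃ xs : StrongDual ℝ X, ‖xs‖ ≤ κ ∧ q ≤ xs (c - u) ∧ ∀ v ∈ V, ∀ p ∈ J,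
    ‖v - u‖ < 1 / ((p.2 : ℝ) + 1) →
      φ u + ((xs (v - u) : ℝ) : EReal) ≤ φ v + ((1 / ((p.1 : ℝ) + 1) * ‖v - u‖ : ℝ) : EReal)

theorem good_compact {X : Type*} [NormedAddCommGroup X] [NormedSpace ℝ X] (φ : X → EReal)
    (hnobot : ∀ x, φ x ≠ ⊥) (c : X) (κ q : ℝ) (hκ : 0 ≤ κ) (J : Set (ℕ × ℕ)) (hJ : J.Nonempty)
    (u : X) (hu : φ u ≠ ⊤)
    (hbad : ¬ GoodAt φ c κ q J Set.univ u) :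
    ∃ (I : Finset (ℕ × ℕ)) (V : Finset X) (θ : ℝ), (I : Set (ℕ × ℕ)) ⊆ J ∧ 0 < θ ∧
      ∀ u', ‖u' - u‖ ≤ θ → φ u ≤ φ u' + (θ : EReal) → φ u' ≠ ⊤ → ¬ GoodAt φ c κ q I V u' := by
  classical
  let F : X → ℝ := fun y => (φ y).toReal
  have hF : ∀ y, φ y ≠ ⊤ → φ y = (F y : EReal) := fun y hy => (EReal.coe_toReal hy (hnobot y)).symm
  let T : X × J × ℕ → Set (WeakDual ℝ X) := fun i =>
    {g | q - 1 / ((i.2.2 : ℝ) + 1) ≤ g (c - u) ∧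
      (φ i.1 ≠ ⊤ → ‖i.1 - u‖ < 1 / (((i.2.1 : ℕ × ℕ).2 : ℝ) + 1) →
        F u + g (i.1 - u) ≤ F i.1 + 1 / (((i.2.1 : ℕ × ℕ).1 : ℝ) + 1) * ‖i.1 - u‖
          + 1 / ((i.2.2 : ℝ) + 1))}
  have huniv : ∀ A : Set (WeakDual ℝ X), (∀ g, g ∈ A) → IsClosed A := fun A h => by
    rw [Set.eq_univ_of_forall h]; exact isClosed_univ
  have hT : ∀ i, IsClosed (T i) := by
    intro i
    refine (isClosed_le continuous_const (WeakDual.eval_continuous _)).inter ?_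
    by_cases h1 : φ i.1 ≠ ⊤
    · by_cases h2 : ‖i.1 - u‖ < 1 / (((i.2.1 : ℕ × ℕ).2 : ℝ) + 1)
      · simp only [h1, h2, ne_eq, not_false_eq_true, forall_true_left]
        exact isClosed_le (continuous_const.add (WeakDual.eval_continuous _)) continuous_const
      · exact huniv _ fun g _ h => absurd h h2
    · exact huniv _ fun g h => absurd h h1
  have hlim : ∀ x y : ℝ, (∀ k : ℕ, x ≤ y + 1 / ((k : ℝ) + 1)) → x ≤ y := by
    intro x y h
    refine le_of_forall_pos_le_add fun ε hε => ?_
    obtain ⟨k, hk⟩ := exists_nat_one_div_lt hε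
    exact (h k).trans (by linarith)
  obtain ⟨W, hW⟩ := (WeakDual.isCompact_closedBall (𝕜 := ℝ) (E := X) 0 κ).elim_finite_subfamily_closed T hT (by
    by_contra hcon
    obtain ⟨g, hg1, hg2⟩ := Set.nonempty_iff_ne_empty.2 hcon
    rw [Set.mem_iInter] at hg2
    apply hbad
    obtain ⟨p0, hp0⟩ := hJ
    refine ⟨WeakDual.toStrongDual g, ?_, ?_, ?_⟩
    · simpa using hg1
    · change q ≤ g (c - u)
      refine hlim _ _ fun k => ?_
      have := (hg2 (u, ⟨p0, hp0⟩, k)).1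
      simp only at this
      linarith
    · intro v _ p hp hlt
      by_cases hv : φ v = ⊤
      · rw [hv, EReal.top_add_coe]; exact le_top
      · rw [hF u hu, hF v hv]
        rw [← EReal.coe_add, ← EReal.coe_add, EReal.coe_le_coe_iff]
        change F u + g (v - u) ≤ _
        refine hlim _ _ fun k => ?_
        exact (hg2 (v, ⟨p, hp⟩, k)).2 hv hlt)
  have hθ : ∀ i ∈ W, ∀ᶠ θ : ℝ in 𝓝[>] 0, (2 + κ) * θ ≤ 1 / ((i.2.2 : ℝ) + 1) ∧
      (‖i.1 - u‖ < 1 / (((i.2.1 : ℕ × ℕ).2 : ℝ) + 1) →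
        ‖i.1 - u‖ + θ < 1 / (((i.2.1 : ℕ × ℕ).2 : ℝ) + 1)) := by
    intro i _
    have hpos : (0 : ℝ) < 1 / ((i.2.2 : ℝ) + 1) := by positivity
    have c1 : ContinuousAt (fun θ : ℝ => (2 + κ) * θ) 0 := by fun_prop
    have c2 : ContinuousAt (fun θ : ℝ => ‖i.1 - u‖ + θ) 0 := by fun_prop
    have e1 : ∀ᶠ θ : ℝ in 𝓝 0, (2 + κ) * θ < 1 / ((i.2.2 : ℝ) + 1) :=
      c1.eventually_lt continuousAt_const (by simpa using hpos)
    refine Filter.Eventually.filter_mono nhdsWithin_le_nhds ?_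
    by_cases h : ‖i.1 - u‖ < 1 / (((i.2.1 : ℕ × ℕ).2 : ℝ) + 1)
    · have e2 : ∀ᶠ θ : ℝ in 𝓝 0, ‖i.1 - u‖ + θ < 1 / (((i.2.1 : ℕ × ℕ).2 : ℝ) + 1) :=
        c2.eventually_lt continuousAt_const (by simpa using h)
      filter_upwards [e1, e2] with θ h1 h2
      exact ⟨h1.le, fun _ => h2⟩
    · filter_upwards [e1] with θ h1
      exact ⟨h1.le, fun h' => absurd h' h⟩
  obtain ⟨θ, hθW, hθ0⟩ := ((W.eventually_all.2 hθ).and self_mem_nhdsWithin).exists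
  have hθ0 : 0 < θ := hθ0
  refine ⟨W.image fun i => (i.2.1 : ℕ × ℕ), W.image fun i => i.1, θ, ?_, hθ0, ?_⟩
  · intro p hp
    simp only [Finset.coe_image, Set.mem_image] at hp
    obtain ⟨i, _, rfl⟩ := hp
    exact i.2.1.2
  · rintro u' hu' hφ hu'top ⟨xs, hn, hq, hxs⟩
    have hmem : StrongDual.toWeakDual xs ∈ (WeakDual.toStrongDual ⁻¹' Metric.closedBall (0 : StrongDual ℝ X) κ ∩
        ⋂ i ∈ W, T i) := by
      refine ⟨by simpa using hn, ?_⟩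
      refine Set.mem_iInter₂.2 fun i hi => ?_
      have hxb : |xs (u' - u)| ≤ κ * θ := by
        have := xs.le_opNorm (u' - u)
        rw [Real.norm_eq_abs] at this
        exact this.trans (mul_le_mul hn hu' (norm_nonneg _) hκ)
      rw [abs_le] at hxb
      obtain ⟨hk, hm⟩ := hθW i hi
      refine ⟨?_, ?_⟩
      · change _ ≤ xs (c - u)
        have : c - u = (c - u') + (u' - u) := by abel
        rw [this, map_add]
        nlinarith
      · intro hv hlt
        change F u + xs (i.1 - u) ≤ _
        have hvu : ‖i.1 - u'‖ ≤ ‖i.1 - u‖ + θ := by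
          have : i.1 - u' = (i.1 - u) - (u' - u) := by abel
          rw [this]
          exact (norm_sub_le _ _).trans (by linarith)
        have := hxs i.1 (Finset.mem_coe.2 (Finset.mem_image_of_mem (fun i : X × J × ℕ => i.1) hi)) (i.2.1 : ℕ × ℕ)
          (Finset.mem_coe.2 (Finset.mem_image_of_mem (fun i : X × J × ℕ => (i.2.1 : ℕ × ℕ)) hi))
          (hvu.trans_lt (hm hlt))
        rw [hF u' hu'top, hF i.1 hv] at this
        rw [hF u' hu'top, hF u hu] at hφ
        rw [← EReal.coe_add, ← EReal.coe_add, EReal.coe_le_coe_iff] at this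
        rw [← EReal.coe_add, EReal.coe_le_coe_iff] at hφ
        have e : i.1 - u = (i.1 - u') + (u' - u) := by abel
        have exs : xs (i.1 - u) = xs (i.1 - u') + xs (u' - u) := by rw [e, map_add]
        have hle1 : 1 / (((i.2.1 : ℕ × ℕ).1 : ℝ) + 1) ≤ 1 := by
          rw [div_le_one (by positivity)]
          linarith [Nat.cast_nonneg (α := ℝ) (i.2.1 : ℕ × ℕ).1]
        have hpos : 0 < 1 / (((i.2.1 : ℕ × ℕ).1 : ℝ) + 1) := by positivity
        have h3 : 1 / (((i.2.1 : ℕ × ℕ).1 : ℝ) + 1) * ‖i.1 - u'‖ ≤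
            1 / (((i.2.1 : ℕ × ℕ).1 : ℝ) + 1) * ‖i.1 - u‖ + θ := by
          calc _ ≤ 1 / (((i.2.1 : ℕ × ℕ).1 : ℝ) + 1) * (‖i.1 - u‖ + θ) := by gcongr
            _ ≤ _ := by
              rw [mul_add]
              have : 1 / (((i.2.1 : ℕ × ℕ).1 : ℝ) + 1) * θ ≤ 1 * θ := by gcongr
              linarith
        rw [exs]
        nlinarith
    rw [hW] at hmem
    exact hmem

/-- countable closure -/
theorem countable_closed {X : Type*} [AddCommGroup X] [Module ℚ X] (W : X → Set X)
    (hW : ∀ x, (W x).Countable) (C0 : Set X) (hC0 : C0.Countable) :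
    ∃ D : Set X, D.Countable ∧ C0 ⊆ D ∧ (∀ x ∈ D, W x ⊆ D) ∧ (∀ x ∈ D, ∀ y ∈ D, x + y ∈ D) ∧
      (∀ r : ℚ, ∀ x ∈ D, r • x ∈ D) := by
  let step : Set X → Set X := fun D => D ∪ (⋃ x ∈ D, W x) ∪ Set.image2 (· + ·) D D ∪
    Set.image2 (fun (r : ℚ) x => r • x) Set.univ D
  have hstep : ∀ D : Set X, D.Countable → (step D).Countable := by
    intro D hD
    refine ((hD.union (hD.biUnion fun x _ => hW x)).union (hD.image2 hD _)).union ?_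
    exact Set.countable_univ.image2 hD _
  let Dn : ℕ → Set X := fun n => step^[n] C0
  have hDs : ∀ n, Dn (n + 1) = step (Dn n) := fun n => Function.iterate_succ_apply' step n C0
  have hDc : ∀ n, (Dn n).Countable := by
    intro n
    induction n with
    | zero => exact hC0
    | succ n ih => rw [hDs]; exact hstep _ ih
  have hmono : Monotone Dn := monotone_nat_of_le_succ fun n => by
    rw [hDs]
    intro x hx
    exact Or.inl (Or.inl (Or.inl hx))
  refine ⟨⋃ n, Dn n, Set.countable_iUnion hDc, Set.subset_iUnion Dn 0, ?_, ?_, ?_⟩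
  · intro x hx y hy
    obtain ⟨n, hn⟩ := Set.mem_iUnion.1 hx
    refine Set.mem_iUnion.2 ⟨n + 1, ?_⟩
    rw [hDs]
    exact Or.inl (Or.inl (Or.inr (Set.mem_biUnion hn hy)))
  · intro x hx y hy
    obtain ⟨n, hn⟩ := Set.mem_iUnion.1 hx
    obtain ⟨m, hm⟩ := Set.mem_iUnion.1 hy
    refine Set.mem_iUnion.2 ⟨max n m + 1, ?_⟩
    rw [hDs]
    exact Or.inl (Or.inr ⟨x, hmono (le_max_left _ _) hn, y, hmono (le_max_right _ _) hm, rfl⟩)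
  · intro r x hx
    obtain ⟨n, hn⟩ := Set.mem_iUnion.1 hx
    refine Set.mem_iUnion.2 ⟨n + 1, ?_⟩
    rw [hDs]
    exact Or.inr ⟨r, Set.mem_univ _, x, hn, rfl⟩

/-- The closure of a countable rational subspace is a closed separable real subspace. -/
theorem exists_sep_subspace {X : Type*} [NormedAddCommGroup X] [NormedSpace ℝ X] (W : X → Set X)
    (hW : ∀ x, (W x).Countable) (C0 : Set X) (hC0 : C0.Countable) (hne : C0.Nonempty) :
    ∃ (D : Set X) (Y : Submodule ℝ X), IsClosed (Y : Set X) ∧ TopologicalSpace.SeparableSpace Y ∧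
      C0 ⊆ D ∧ (∀ x ∈ D, W x ⊆ D) ∧ D ⊆ Y ∧ ∀ y ∈ Y, ∀ ε : ℝ, 0 < ε → ∃ x ∈ D, ‖y - x‖ < ε := by
  letI : Module ℚ X := Module.compHom X (algebraMap ℚ ℝ)
  obtain ⟨D, hDc, hCD, hWD, hadd, hsmul⟩ := countable_closed W hW C0 hC0
  have hsm : ∀ (r : ℚ) (x : X), r • x = (r : ℝ) • x := fun r x => rfl
  let Y : Submodule ℝ X :=
    { carrier := closure D
      add_mem' := by
        intro x y hx hy
        exact map_mem_closure₂ continuous_add hx hy hadd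
      zero_mem' := by
        obtain ⟨x, hx⟩ := hne
        have := hsmul 0 x (hCD hx)
        rw [zero_smul] at this
        exact subset_closure this
      smul_mem' := by
        intro r x hx
        have hr : r ∈ closure (Set.range ((↑) : ℚ → ℝ)) := Rat.denseRange_cast r
        refine map_mem_closure₂ continuous_smul hr hx ?_
        rintro _ ⟨q, rfl⟩ y hy
        exact hsmul q y hy }
  refine ⟨D, Y, isClosed_closure, ?_, hCD, hWD, subset_closure, ?_⟩
  · exact (hDc.isSeparable.closure).separableSpace
  · intro y hy ε hε
    obtain ⟨x, hx, hd⟩ := Metric.mem_closure_iff.1 hy ε hε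
    exact ⟨x, hx, by rwa [← dist_eq_norm]⟩

/-- Separable reduction for Fréchet subgradients. -/
theorem sep_reduction {X : Type*} [NormedAddCommGroup X] [NormedSpace ℝ X] (φ : X → EReal)
    (hnobot : ∀ x, φ x ≠ ⊥) (c : X) (C0 : Set X) (hC0 : C0.Countable) (hne : C0.Nonempty) :
    ∃ Y : Submodule ℝ X, IsClosed (Y : Set X) ∧ TopologicalSpace.SeparableSpace Y ∧ C0 ⊆ Y ∧
      ∀ u : Y, ∀ ys ∈ FrechetSubdiff (fun y : Y => φ y) u, ∀ c' : Y, (c' : X) = c →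
        0 < ys (c' - u) → ∃ us ∈ FrechetSubdiff φ (u : X), 0 < us (c - u) := by
  classical
  let P : X → ℕ × ℚ × ℕ × ℕ × Finset (ℕ × ℕ) → Finset X → Prop := fun x e V =>
    ∀ u' : X, ‖u' - x‖ < 1 / ((e.1 : ℝ) + 1) → (((e.2.1 : ℝ)) : EReal) < φ u' → φ u' ≠ ⊤ →
      ¬ GoodAt φ c (e.2.2.1 : ℝ) (1 / ((e.2.2.2.1 : ℝ) + 1)) e.2.2.2.2 V u'
  let W : X → Set X := fun x => ⋃ e, if h : ∃ V : Finset X, P x e V then (h.choose : Set X) else ∅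
  have hW : ∀ x, (W x).Countable := by
    intro x
    refine Set.countable_iUnion fun e => ?_
    split_ifs with h
    · exact Finset.countable_toSet _
    · exact Set.countable_empty
  obtain ⟨D, Y, hYc, hYs, hCD, hWD, hDY, hdense⟩ := exists_sep_subspace W hW C0 hC0 hne
  refine ⟨Y, hYc, hYs, hCD.trans hDY, ?_⟩
  intro u ys hys c' hc' hpos
  obtain ⟨hutop, hys⟩ := hys
  have hutop : φ (u : X) ≠ ⊤ := hutop
  obtain ⟨κ, hκ⟩ := exists_nat_ge ‖ys‖
  obtain ⟨k, hk⟩ := exists_nat_one_div_lt hpos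
  have hm : ∀ n : ℕ, ∃ m : ℕ, ∀ v : Y, ‖(v : X) - u‖ < 1 / ((m : ℝ) + 1) →
      φ u + ((ys (v - u) : ℝ) : EReal) ≤ φ v + ((1 / ((n : ℝ) + 1) * ‖(v : X) - u‖ : ℝ) : EReal) := by
    intro n
    obtain ⟨δ, hδ, h⟩ := Metric.eventually_nhds_iff.1 (hys (1 / ((n : ℝ) + 1)) (by positivity))
    obtain ⟨m, hm⟩ := exists_nat_one_div_lt hδ
    refine ⟨m, fun v hv => ?_⟩
    have := h (y := v) (by
      rw [dist_eq_norm]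
      exact lt_trans hv hm)
    rw [EReal.sub_le_iff_le_add (Or.inl (EReal.coe_ne_bot _)) (Or.inl (EReal.coe_ne_top _))] at this
    exact this
  choose m hm using hm
  let J : Set (ℕ × ℕ) := Set.range fun n => (n, m n)
  by_cases hgood : GoodAt φ c κ (1 / ((k : ℝ) + 1)) J Set.univ (u : X)
  · obtain ⟨xs, _, hq, hxs⟩ := hgood
    refine ⟨xs, ⟨hutop, ?_⟩, lt_of_lt_of_le (by positivity) hq⟩
    intro ε hε
    obtain ⟨n, hn⟩ := exists_nat_one_div_lt hε
    have hmp : (0 : ℝ) < 1 / ((m n : ℝ) + 1) := by positivity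
    filter_upwards [Metric.ball_mem_nhds (u : X) hmp] with v hv
    rw [Metric.mem_ball, dist_eq_norm] at hv
    rw [EReal.sub_le_iff_le_add (Or.inl (EReal.coe_ne_bot _)) (Or.inl (EReal.coe_ne_top _))]
    refine (hxs v trivial (n, m n) ⟨n, rfl⟩ hv).trans ?_
    refine add_le_add le_rfl ?_
    rw [EReal.coe_le_coe_iff]
    exact mul_le_mul_of_nonneg_right hn.le (norm_nonneg _)
  · exfalso
    obtain ⟨I, V, θ, hIJ, hθ, hV⟩ := good_compact φ hnobot c κ _ (Nat.cast_nonneg κ) J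
      ⟨_, 0, rfl⟩ (u : X) hutop hgood
    obtain ⟨j, hj⟩ := exists_nat_one_div_lt (half_pos hθ)
    have hF : φ (u : X) = (((φ u).toReal : ℝ) : EReal) := (EReal.coe_toReal hutop (hnobot _)).symm
    obtain ⟨r, hr1, hr2⟩ := exists_rat_btwn (sub_lt_self (φ (u : X)).toReal hθ)
    obtain ⟨x, hxD, hx⟩ := hdense u u.2 (1 / ((j : ℝ) + 1)) (by positivity)
    have hex : ∃ V : Finset X, P x (j, r, κ, k, I) V := by
      refine ⟨V, fun u' h1 h2 h3 => hV u' ?_ ?_ h3⟩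
      · have : u' - u = (u' - x) - (u - x) := by abel
        rw [this]
        refine (norm_sub_le _ _).trans ?_
        simp only at h1
        linarith
      · have h4 : φ (u : X) ≤ ((r : ℝ) : EReal) + (θ : EReal) := by
          rw [hF, ← EReal.coe_add, EReal.coe_le_coe_iff]
          linarith
        exact h4.trans (add_le_add h2.le le_rfl)
    have hVD : (hex.choose : Set X) ⊆ D := by
      refine subset_trans ?_ (hWD x hxD)
      refine subset_trans ?_ (Set.subset_iUnion _ (j, r, κ, k, I))
      rw [dif_pos hex]
    refine hex.choose_spec u hx ?_ hutop ?_
    · rw [hF, EReal.coe_lt_coe_iff]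
      exact hr2
    · obtain ⟨g, hg, hgn⟩ := exists_extension_norm_eq Y ys
      refine ⟨g, hgn.trans_le hκ, ?_, ?_⟩
      · have := hg (c' - u)
        rw [Submodule.coe_sub, hc'] at this
        rw [this]
        exact hk.le
      · intro v hv p hp hlt
        obtain ⟨n, rfl⟩ := hIJ hp
        have := hg (⟨v, hDY (hVD hv)⟩ - u)
        rw [Submodule.coe_sub] at this
        simp only at this
        rw [this]
        exact hm n ⟨v, hDY (hVD hv)⟩ hlt

/-- Approximate mean value inequality in Asplund spaces. -/
theorem asplund_mvt {X : Type*} [NormedAddCommGroup X] [NormedSpace ℝ X] [CompleteSpace X]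
    (hX : IsAsplund X) (φ : X → EReal) (hnobot : ∀ x, φ x ≠ ⊥) (hlsc : LowerSemicontinuous φ)
    (a b : X) (s : ℝ) (hs : 0 < s) (hab : φ a < φ b) (ε : ℝ) (hε : 0 < ε) :
    ∃ t : ℝ, 0 ≤ t ∧ t < 1 ∧ ∃ u, ‖u - (a + t • (b - a))‖ < ε ∧
      ∃ us ∈ FrechetSubdiff φ u, 0 < us (b + s • (b - a) - u) := by
  obtain ⟨Y, hYc, hYs, hCY, hred⟩ := sep_reduction φ hnobot (b + s • (b - a)) {a, b}
    (Set.toFinite _).countable ⟨a, by simp⟩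
  have haY : a ∈ Y := hCY (by simp)
  have hbY : b ∈ Y := hCY (by simp)
  haveI := hYs
  haveI : TopologicalSpace.SeparableSpace (StrongDual ℝ Y) := hX Y hYc hYs
  haveI : CompleteSpace Y := hYc.completeSpace_coe
  obtain ⟨P, C, hC, hP1, hP2, hPl, hPc⟩ := exists_dual_P (Y := Y)
  obtain ⟨Q, D, hQ0, hQl, hQu, hQd, hDn, hDp⟩ := smooth_of_dual P C hC hP1 hP2 hPl hPc
  obtain ⟨t, ht0, ht1, u, hu, us, hus, hpos⟩ := mvt_of_smooth Q D (4 * C) (by positivity) hQ0 hQl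
    hQu hQd hDn hDp (fun y : Y => φ y) (fun y => hnobot y)
    (hlsc.comp continuous_subtype_val) ⟨a, haY⟩ ⟨b, hbY⟩ s hs hab ε hε
  obtain ⟨vs, hvs, hvpos⟩ := hred u us hus _ rfl hpos
  exact ⟨t, ht0, ht1, u, hu, vs, hvs, hvpos⟩

/-- Key half-line property. -/
theorem ray_property {X : Type*} [NormedAddCommGroup X] [NormedSpace ℝ X] [CompleteSpace X]
    (hX : IsAsplund X) (φ : X → EReal) (hnobot : ∀ x, φ x ≠ ⊥) (hlsc : LowerSemicontinuous φ)
    (hqm : ∀ x y : X, ∀ xs ∈ FrechetSubdiff φ x, ∀ ys ∈ FrechetSubdiff φ y,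
      min (xs (y - x)) (ys (x - y)) ≤ 0)
    (x y : X) (xs : X →L[ℝ] ℝ) (hxs : xs ∈ FrechetSubdiff φ x) (hpos : 0 < xs (y - x))
    (θ : ℝ) (h0 : 0 < θ) (h1 : θ < 1) : φ (x + θ • (y - x)) ≤ φ y := by
  by_contra hcon
  push Not at hcon
  have h1' : 0 < 1 - θ := by linarith
  have hε : 0 < θ * xs (y - x) / (‖xs‖ + 1) := by positivity
  obtain ⟨t, ht0, ht1, u, hu, us, hus, huspos⟩ := asplund_mvt hX φ hnobot hlsc y (x + θ • (y - x))
    (θ / (1 - θ)) (by positivity) hcon _ hε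
  have hc : x + θ • (y - x) + (θ / (1 - θ)) • (x + θ • (y - x) - y) = x := by
    have e : x + θ • (y - x) - y = -((1 - θ) • (y - x)) := by module
    rw [e, smul_neg, smul_smul, div_mul_cancel₀ _ h1'.ne']
    abel
  rw [hc] at huspos
  have h := hqm x u xs hxs us hus
  have hxu : 0 < xs (u - x) := by
    have e : u - x = (u - (y + t • (x + θ • (y - x) - y))) + (1 - t * (1 - θ)) • (y - x) := by module
    rw [e, map_add, map_smul, smul_eq_mul]
    have h2 := xs.le_opNorm (u - (y + t • (x + θ • (y - x) - y)))
    rw [Real.norm_eq_abs] at h2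
    have h3 : ‖xs‖ * ‖u - (y + t • (x + θ • (y - x) - y))‖ < θ * xs (y - x) := by
      rw [lt_div_iff₀ (by positivity)] at hu
      nlinarith [norm_nonneg (u - (y + t • (x + θ • (y - x) - y))), norm_nonneg xs]
    have h4 := neg_abs_le (xs (u - (y + t • (x + θ • (y - x) - y))))
    have h5 : θ * xs (y - x) ≤ (1 - t * (1 - θ)) * xs (y - x) := by
      refine mul_le_mul_of_nonneg_right ?_ hpos.le
      nlinarith
    linarith
  exact absurd h (not_le.2 (lt_min hxu huspos))

/-- Theorem 2.5, (c) ⇒ (a): in an Asplund space, quasimonotonicity of `∂̂φ`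
implies quasiconvexity of `φ`. -/
theorem quasimonotone_imp_quasiconvex
    {X : Type*} [NormedAddCommGroup X] [NormedSpace ℝ X] [CompleteSpace X]
    (hX : IsAsplund X) (φ : X → EReal)
    (hproper : ∃ x, φ x ≠ ⊤) (hnobot : ∀ x, φ x ≠ ⊥)
    (hlsc : LowerSemicontinuous φ)
    (hqm : ∀ x y : X, ∀ xs ∈ FrechetSubdiff φ x, ∀ ys ∈ FrechetSubdiff φ y,
      min (xs (y - x)) (ys (x - y)) ≤ 0) :
    QuasiconvexFn φ := by
  intro x y l hl0 hl1
  by_contra hcon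
  push Not at hcon
  have hl1' : 0 < 1 - l := by linarith
  obtain ⟨hzx, hzy⟩ := max_lt_iff.1 hcon
  obtain ⟨ε, hε, hball⟩ := Metric.eventually_nhds_iff.1 (hlsc _ _ hzy)
  obtain ⟨t, ht0, ht1, u, hu, us, hus, hpos⟩ := asplund_mvt hX φ hnobot hlsc x (l • x + (1 - l) • y)
    (l / (1 - l)) (by positivity) hzx ε hε
  have hc : l • x + (1 - l) • y + (l / (1 - l)) • (l • x + (1 - l) • y - x) = y := by
    have e : l • x + (1 - l) • y - x = (1 - l) • (y - x) := by module
    rw [e, smul_smul, div_mul_cancel₀ _ hl1'.ne']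
    module
  rw [hc] at hpos
  have hden : 0 < 1 - t * (1 - l) := by nlinarith
  obtain ⟨θ, hθ⟩ : ∃ θ, θ = (1 - l) * (1 - t) / (1 - t * (1 - l)) := ⟨_, rfl⟩
  have hθ0 : 0 < θ := by
    rw [hθ]
    exact div_pos (mul_pos hl1' (by linarith)) hden
  have hθ1 : θ < 1 := by
    rw [hθ, div_lt_one hden]
    nlinarith
  have hθe : θ * (1 - t * (1 - l)) = (1 - l) * (1 - t) := by
    rw [hθ, div_mul_cancel₀ _ hden.ne']
  have hray := ray_property hX φ hnobot hlsc hqm u y us hus hpos θ hθ0 hθ1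
  have hw : u + θ • (y - u) - (l • x + (1 - l) • y) =
      (1 - θ) • (u - (x + t • (l • x + (1 - l) • y - x))) := by
    have h2 : (1 - l) = θ + (1 - θ) * (t * (1 - l)) := by linarith
    have e1 : u + θ • (y - u) - (l • x + (1 - l) • y) =
      (1 - θ) • u + θ • (y - x) - x + θ • x - (1 - l) • (y - x) := by module
    have e2 : (1 - θ) • (u - (x + t • (l • x + (1 - l) • y - x))) =
      (1 - θ) • u - x + θ • x - ((1 - θ) * (t * (1 - l))) • (y - x) := by module
    have e3 : (1 - l) • (y - x) = (θ + (1 - θ) * (t * (1 - l))) • (y - x) := by rw [← h2]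
    rw [e1, e2, e3]
    module
  have hlt := hball (y := u + θ • (y - u)) (by
    rw [dist_eq_norm, hw, norm_smul, Real.norm_eq_abs, abs_of_pos (by linarith)]
    refine lt_of_le_of_lt ?_ hu
    exact mul_le_of_le_one_left (norm_nonneg _) (by linarith))
  exact absurd hray (not_le.2 hlt)
end

section
/- Let X be an Asplund space and φ : X → ℝ ∪ {+∞} a proper lower semicontinuous function. Then the following statements are equivalent: (a) φ is quasiconvex; (b) for all x, y ∈ X with φ(y) ≤ φ(x) and all x* ∈ ∂̂φ(x), one has ⟨x*, y − x⟩ ≤ 0; (c) the set-valued operator ∂̂φ is quasimonotone. -/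
open Filter Topology

section Theta

variable {X : Type*} [NormedAddCommGroup X] [NormedSpace ℝ X]

/-- restriction of `p` to the kernel of `g` -/
noncomputable def resK (g p : StrongDual ℝ X) : StrongDual ℝ (LinearMap.ker (g : X →ₗ[ℝ] ℝ)) :=
  p.comp (LinearMap.ker (g : X →ₗ[ℝ] ℝ)).subtypeL

lemma resK_apply (g p : StrongDual ℝ X) (x : LinearMap.ker (g : X →ₗ[ℝ] ℝ)) :
    resK g p x = p x := rfl

/-- norm of the restriction of `p` to the kernel of `g` -/
noncomputable def kerN (g p : StrongDual ℝ X) : ℝ := ‖resK g p‖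

lemma kerN_nonneg (g p : StrongDual ℝ X) : 0 ≤ kerN g p := norm_nonneg (resK g p)

lemma kerN_le (g p : StrongDual ℝ X) : kerN g p ≤ ‖p‖ := by
  refine ContinuousLinearMap.opNorm_le_bound _ (norm_nonneg _) fun x => ?_
  exact p.le_opNorm x

lemma kerN_add (g p q : StrongDual ℝ X) : kerN g (p + q) ≤ kerN g p + kerN g q := by
  have : resK g (p + q) = resK g p + resK g q := rfl
  unfold kerN
  rw [this]
  exact norm_add_le (resK g p) (resK g q)

lemma kerN_half (g p : StrongDual ℝ X) : kerN g ((1/2 : ℝ) • p) ≤ (1/2) * kerN g p := by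
  refine ContinuousLinearMap.opNorm_le_bound _
    (mul_nonneg (by norm_num) (kerN_nonneg g p)) fun x => ?_
  have h1 : ‖resK g p x‖ ≤ kerN g p * ‖x‖ := (resK g p).le_opNorm x
  have h2 : resK g ((1/2 : ℝ) • p) x = (1/2 : ℝ) * resK g p x := rfl
  rw [h2, norm_mul, mul_assoc]
  norm_num
  exact h1

lemma kerN_sub_self (g p : StrongDual ℝ X) : kerN g p ≤ ‖p - g‖ := by
  have : kerN g p = kerN g (p - g) := by
    unfold kerN
    congr 1
    ext x
    have := x.2
    rw [LinearMap.mem_ker] at this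
    simp only [ContinuousLinearMap.coe_coe] at this
    simp [resK_apply, this]
  rw [this]; exact kerN_le _ _

lemma kerN_decomp (g p : StrongDual ℝ X) : ∃ (t : ℝ) (r : StrongDual ℝ X),
    p = t • g + r ∧ ‖r‖ = kerN g p := by
  obtain ⟨r, hr, hn⟩ := exists_extension_norm_eq (LinearMap.ker (g : X →ₗ[ℝ] ℝ)) (resK g p)
  have hker : LinearMap.ker (g : X →ₗ[ℝ] ℝ) ≤ LinearMap.ker ((p - r : StrongDual ℝ X) : X →ₗ[ℝ] ℝ) := by
    intro x hx
    have := hr ⟨x, hx⟩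
    simp [resK_apply] at this
    simp [this]
  have h2 := mem_span_of_iInf_ker_le_ker (ι := Unit) (L := fun _ => (g : X →ₗ[ℝ] ℝ))
    (K := ((p - r : StrongDual ℝ X) : X →ₗ[ℝ] ℝ)) (by simpa using hker)
  simp only [Set.range_const, Submodule.mem_span_singleton] at h2
  obtain ⟨t, ht⟩ := h2
  refine ⟨t, r, ?_, hn⟩
  ext x
  have := LinearMap.congr_fun ht x
  simp at this
  simp [this]

noncomputable def PhiT (g : ℕ → StrongDual ℝ X) (y : ℕ → X) (p : StrongDual ℝ X) (k : ℕ) : ℝ :=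
  (1/2 : ℝ)^k * (kerN (g k) p ^ 2 + (p (y k)) ^ 2)

noncomputable def PhiF (g : ℕ → StrongDual ℝ X) (y : ℕ → X) (p : StrongDual ℝ X) : ℝ :=
  ∑' k, PhiT g y p k

lemma PhiT_nonneg (g : ℕ → StrongDual ℝ X) (y : ℕ → X) (p : StrongDual ℝ X) (k : ℕ) :
    0 ≤ PhiT g y p k := by unfold PhiT; positivity

lemma PhiT_le (g : ℕ → StrongDual ℝ X) (y : ℕ → X) (hy : ∀ k, ‖y k‖ ≤ 1)
    (p : StrongDual ℝ X) (k : ℕ) :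
    PhiT g y p k ≤ (1/2 : ℝ)^k * (2 * ‖p‖^2) := by
  unfold PhiT
  have h1 := kerN_le (g k) p
  have h0 := kerN_nonneg (g k) p
  have h2 : |p (y k)| ≤ ‖p‖ := by
    have := p.le_opNorm (y k)
    rw [Real.norm_eq_abs] at this
    nlinarith [hy k, norm_nonneg p]
  have h3 := abs_le.1 h2
  gcongr
  nlinarith

lemma PhiT_summable (g : ℕ → StrongDual ℝ X) (y : ℕ → X) (hy : ∀ k, ‖y k‖ ≤ 1)
    (p : StrongDual ℝ X) : Summable (PhiT g y p) :=
  Summable.of_nonneg_of_le (PhiT_nonneg g y p) (PhiT_le g y hy p)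
    ((summable_geometric_of_lt_one (by norm_num) (by norm_num)).mul_right _)

lemma PhiF_nonneg (g : ℕ → StrongDual ℝ X) (y : ℕ → X) (p : StrongDual ℝ X) :
    0 ≤ PhiF g y p := tsum_nonneg (PhiT_nonneg g y p)

lemma PhiF_le (g : ℕ → StrongDual ℝ X) (y : ℕ → X) (hy : ∀ k, ‖y k‖ ≤ 1)
    (p : StrongDual ℝ X) : PhiF g y p ≤ 4 * ‖p‖^2 := by
  have h := (PhiT_summable g y hy p).tsum_le_tsum (PhiT_le g y hy p)
    ((summable_geometric_of_lt_one (by norm_num) (by norm_num)).mul_right _)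
  rw [tsum_mul_right, tsum_geometric_of_lt_one (by norm_num) (by norm_num)] at h
  unfold PhiF
  norm_num at h ⊢
  linarith

/-- midpoint estimate -/
lemma PhiF_mid (g : ℕ → StrongDual ℝ X) (y : ℕ → X) (hy : ∀ k, ‖y k‖ ≤ 1)
    (p q : StrongDual ℝ X) (k : ℕ) :
    (1/2 : ℝ)^k * ((kerN (g k) p - kerN (g k) q)^2 + (p (y k) - q (y k))^2) ≤
      2 * PhiF g y p + 2 * PhiF g y q - 4 * PhiF g y ((1/2 : ℝ) • p + (1/2 : ℝ) • q) := by
  set m := (1/2 : ℝ) • p + (1/2 : ℝ) • q with hm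
  have key : ∀ j, (1/2 : ℝ)^j * ((kerN (g j) p - kerN (g j) q)^2 + (p (y j) - q (y j))^2) ≤
      2 * PhiT g y p j + 2 * PhiT g y q j - 4 * PhiT g y m j := by
    intro j
    unfold PhiT
    have h1 : kerN (g j) m ≤ (1/2) * kerN (g j) p + (1/2) * kerN (g j) q := by
      exact (kerN_add _ _ _).trans (add_le_add (kerN_half _ _) (kerN_half _ _))
    have h2 : m (y j) = (1/2) * p (y j) + (1/2) * q (y j) := by simp [hm]
    have h3 := kerN_nonneg (g j) m
    have h4 : 0 ≤ (1/2 : ℝ)^j := by positivity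
    have h5 : kerN (g j) m ^ 2 ≤ ((1/2) * kerN (g j) p + (1/2) * kerN (g j) q)^2 := by gcongr
    have : (kerN (g j) p - kerN (g j) q)^2 + (p (y j) - q (y j))^2 ≤
      2 * (kerN (g j) p ^ 2 + (p (y j)) ^ 2) + 2 * (kerN (g j) q ^ 2 + (q (y j)) ^ 2)
       - 4 * (kerN (g j) m ^ 2 + (m (y j)) ^ 2) := by
      rw [h2]; nlinarith
    nlinarith [mul_le_mul_of_nonneg_left this h4]
  have s1 := PhiT_summable g y hy p
  have s2 := PhiT_summable g y hy q
  have s3 := PhiT_summable g y hy m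
  have hs := ((s1.hasSum.mul_left 2).add (s2.hasSum.mul_left 2)).sub (s3.hasSum.mul_left 4)
  refine (key k).trans ?_
  exact le_hasSum hs k fun j _ => le_trans (by positivity) (key j)

lemma kerN_lsc (g : StrongDual ℝ X) :
    LowerSemicontinuous fun p : WeakDual ℝ X => kerN g (WeakDual.toStrongDual p) ^ 2 := by
  rw [lowerSemicontinuous_iff_isClosed_preimage]
  intro c
  by_cases hc : c < 0
  · convert isClosed_empty
    ext p
    simp only [Set.mem_preimage, Set.mem_Iic, Set.mem_empty_iff_false, iff_false, not_le]
    exact hc.trans_le (sq_nonneg _)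
  push Not at hc
  have : (fun p : WeakDual ℝ X => kerN g (WeakDual.toStrongDual p) ^ 2) ⁻¹' Set.Iic c =
      ⋂ x : LinearMap.ker (g : X →ₗ[ℝ] ℝ), {p : WeakDual ℝ X | |p (x : X)| ≤ √c * ‖x‖} := by
    ext p
    simp only [Set.mem_preimage, Set.mem_Iic, Set.mem_iInter, Set.mem_ofPred_eq]
    rw [← Real.le_sqrt (kerN_nonneg _ _) hc]
    unfold kerN
    rw [ContinuousLinearMap.opNorm_le_iff (Real.sqrt_nonneg _)]
    rfl
  rw [this]
  refine isClosed_iInter fun x => isClosed_le ?_ continuous_const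
  exact (WeakDual.eval_continuous (x : X)).abs

lemma PhiF_lsc (g : ℕ → StrongDual ℝ X) (y : ℕ → X) (hy : ∀ k, ‖y k‖ ≤ 1) :
    LowerSemicontinuous fun p : WeakDual ℝ X => PhiF g y (WeakDual.toStrongDual p) := by
  have hT : ∀ k, LowerSemicontinuous fun p : WeakDual ℝ X =>
      PhiT g y (WeakDual.toStrongDual p) k := by
    intro k
    have h1 : LowerSemicontinuous fun p : WeakDual ℝ X =>
        (kerN (g k) (WeakDual.toStrongDual p) ^ 2 + (p (y k)) ^ 2) :=
      (kerN_lsc (g k)).add ((WeakDual.eval_continuous (y k)).pow 2).lowerSemicontinuous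
    exact Continuous.comp_lowerSemicontinuous (g := fun r : ℝ => (1/2 : ℝ)^k * r)
      (by fun_prop) h1 (fun a b hab => by
        show (1/2 : ℝ)^k * a ≤ (1/2 : ℝ)^k * b
        gcongr)
  intro p c hc
  have hs := (PhiT_summable g y hy (WeakDual.toStrongDual p)).hasSum.tendsto_sum_nat
  obtain ⟨n, hn⟩ := (hs.eventually (lt_mem_nhds hc)).exists
  have hl : LowerSemicontinuous fun p : WeakDual ℝ X =>
      ∑ k ∈ Finset.range n, PhiT g y (WeakDual.toStrongDual p) k :=
    lowerSemicontinuous_sum fun k _ => hT k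
  filter_upwards [hl p c hn] with q hq
  exact hq.trans_le ((PhiT_summable g y hy _).sum_le_tsum _ fun j _ => PhiT_nonneg _ _ _ _)

lemma exists_max (g : ℕ → StrongDual ℝ X) (y : ℕ → X) (hy : ∀ k, ‖y k‖ ≤ 1) (x : X) :
    ∃ p : StrongDual ℝ X, ‖p‖ ≤ 1 ∧ ∀ q : StrongDual ℝ X, ‖q‖ ≤ 1 →
      q x - PhiF g y q ≤ p x - PhiF g y p := by
  have hK := WeakDual.isCompact_closedBall (𝕜 := ℝ) (E := X) 0 1
  have hl : LowerSemicontinuous fun p : WeakDual ℝ X =>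
      PhiF g y (WeakDual.toStrongDual p) + (- p x) :=
    (PhiF_lsc g y hy).add (WeakDual.eval_continuous x).neg.lowerSemicontinuous
  obtain ⟨p, hp, hmin⟩ := LowerSemicontinuousOn.exists_isMinOn
    (s := WeakDual.toStrongDual ⁻¹' Metric.closedBall (0 : StrongDual ℝ X) 1)
    ⟨0, by simp⟩ hK (hl.lowerSemicontinuousOn _)
  refine ⟨WeakDual.toStrongDual p, by simpa using hp, fun q hq => ?_⟩
  have := hmin (show StrongDual.toWeakDual q ∈ _ by simpa using hq)
  simp only [Set.mem_ofPred_eq] at this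
  have e1 : (StrongDual.toWeakDual q) x = q x := rfl
  have e2 : WeakDual.toStrongDual (StrongDual.toWeakDual q) = q := rfl
  have e3 : WeakDual.toStrongDual p x = p x := rfl
  rw [e1, e2] at this
  rw [e3]
  linarith

lemma strong_max (g : ℕ → StrongDual ℝ X) (hg : DenseRange g) (y : ℕ → X) (hy : ∀ k, ‖y k‖ ≤ 1)
    (hgy : ∀ k, ‖g k‖ ≤ 2 * g k (y k))
    (x : X) (p : StrongDual ℝ X) (hp : ‖p‖ ≤ 1) (hmax : ∀ q : StrongDual ℝ X, ‖q‖ ≤ 1 →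
      q x - PhiF g y q ≤ p x - PhiF g y p) (η : ℝ) (hη : 0 < η) :
    ∃ δ > 0, ∀ q : StrongDual ℝ X, ‖q‖ ≤ 1 → p x - PhiF g y p - δ ≤ q x - PhiF g y q →
      ‖q - p‖ ≤ 11 * η := by
  obtain ⟨k, hk⟩ := hg.exists_dist_lt p hη
  rw [dist_eq_norm] at hk
  refine ⟨(1/2 : ℝ)^k * η^2 / 2, by positivity, fun q hq hle => ?_⟩
  have hmid := PhiF_mid g y hy q p k
  have hm := hmax ((1/2 : ℝ) • q + (1/2 : ℝ) • p) (by
    refine (norm_add_le _ _).trans ?_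
    rw [norm_smul, norm_smul]
    norm_num
    linarith)
  simp only [add_apply, smul_apply, smul_eq_mul] at hm
  have h1 : (1/2 : ℝ)^k * ((kerN (g k) q - kerN (g k) p)^2 + (q (y k) - p (y k))^2) ≤
      (1/2 : ℝ)^k * η^2 := by linarith
  have h2 := le_of_mul_le_mul_left h1 (by positivity)
  have h3 : |kerN (g k) q - kerN (g k) p| ≤ η :=
    abs_le_of_sq_le_sq (by nlinarith [sq_nonneg (q (y k) - p (y k))]) hη.le
  have h4 : |q (y k) - p (y k)| ≤ η :=
    abs_le_of_sq_le_sq (by nlinarith [sq_nonneg (kerN (g k) q - kerN (g k) p)]) hη.le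
  have h5 := kerN_sub_self (g k) p
  obtain ⟨t, r, hqr, hr⟩ := kerN_decomp (g k) q
  have hr2 : ‖r‖ ≤ 2 * η := by
    rw [hr]; linarith [(abs_le.1 h3).2]
  -- q - p = (t-1) g + r - (p - g)
  have e : q - p = (t - 1) • g k + (r - (p - g k)) := by
    rw [hqr]; module
  have hs : ‖r - (p - g k)‖ ≤ 3 * η := (norm_sub_le _ _).trans (by linarith)
  have hsy : |(r - (p - g k)) (y k)| ≤ 3 * η := by
    have := (r - (p - g k)).le_opNorm (y k)
    rw [Real.norm_eq_abs] at this
    nlinarith [hy k, norm_nonneg (r - (p - g k))]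
  have h6 : (t - 1) * g k (y k) = (q (y k) - p (y k)) - (r - (p - g k)) (y k) := by
    have := congrArg (fun l : StrongDual ℝ X => l (y k)) e
    simp at this
    simp
    linarith
  have h7 : |t - 1| * g k (y k) ≤ 4 * η := by
    have : |(t - 1) * g k (y k)| ≤ 4 * η := by
      rw [h6]
      refine (abs_sub _ _).trans ?_
      linarith
    rw [abs_mul] at this
    exact (mul_le_mul_of_nonneg_left (le_abs_self _) (abs_nonneg _)).trans this
  have h8 : |t - 1| * ‖g k‖ ≤ 8 * η := by
    have := mul_le_mul_of_nonneg_left (hgy k) (abs_nonneg (t - 1))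
    linarith
  rw [e]
  refine (norm_add_le _ _).trans ?_
  rw [norm_smul, Real.norm_eq_abs]
  linarith

lemma exists_norming (g : StrongDual ℝ X) : ∃ y : X, ‖y‖ ≤ 1 ∧ ‖g‖ ≤ 2 * g y := by
  by_cases h : ‖g‖ = 0
  · exact ⟨0, by simp, by simp [h]⟩
  have h' : 0 < ‖g‖ := lt_of_le_of_ne (norm_nonneg _) (Ne.symm h)
  obtain ⟨x, hx, hx2⟩ := g.exists_lt_apply_of_lt_opNorm (half_lt_self h')
  rw [Real.norm_eq_abs] at hx2
  rcases le_total 0 (g x) with h0 | h0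
  · rw [abs_of_nonneg h0] at hx2
    exact ⟨x, hx.le, by linarith⟩
  · rw [abs_of_nonpos h0] at hx2
    exact ⟨-x, by simpa using hx.le, by rw [map_neg]; linarith⟩

/-- Data of a Fréchet smooth gauge. -/
structure SmoothGauge (θ : X → ℝ) (P : X → StrongDual ℝ X) : Prop where
  zero : θ 0 = 0
  nonneg : ∀ x, 0 ≤ θ x
  lip : ∀ x y, θ x - θ y ≤ ‖x - y‖
  P_le : ∀ x, ‖P x‖ ≤ 1
  P_self : ∀ x, 0 ≤ P x x
  deriv : ∀ x, HasFDerivAt θ (P x) x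
  sep : ∀ r > 0, ∃ κ > 0, ∀ x, θ x < κ → ‖x‖ < r

theorem exists_smoothGauge [TopologicalSpace.SeparableSpace (StrongDual ℝ X)] :
    ∃ (θ : X → ℝ) (P : X → StrongDual ℝ X), SmoothGauge θ P := by
  obtain ⟨g, hg⟩ := TopologicalSpace.exists_dense_seq (StrongDual ℝ X)
  choose y hy hgy using fun k => exists_norming (g k)
  choose P hP hmax using exists_max g y hy
  set θ : X → ℝ := fun x => P x x - PhiF g y (P x) with hθ
  have hsub : ∀ x z, θ x - θ z ≤ P x (x - z) := by
    intro x z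
    have := hmax z (P x) (hP x)
    simp only [hθ, map_sub]
    linarith
  have hPx : ∀ x z, |P x z| ≤ ‖z‖ := by
    intro x z
    have := (P x).le_opNorm z
    rw [Real.norm_eq_abs] at this
    nlinarith [hP x, norm_nonneg z]
  have hlow : ∀ x (q : StrongDual ℝ X), ‖q‖ ≤ 1 → q x - 4 * ‖q‖^2 ≤ θ x := by
    intro x q hq
    have := hmax x q hq
    have := PhiF_le g y hy q
    simp only [hθ]; linarith
  have hnn : ∀ x, 0 ≤ θ x := fun x => by simpa using hlow x 0 (by simp)
  refine ⟨θ, P, ?_, hnn, ?_, hP, ?_, ?_, ?_⟩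
  · have := hnn 0
    have h2 := PhiF_nonneg g y (P 0)
    simp only [hθ, map_zero] at this ⊢
    linarith
  · intro x z
    exact (hsub x z).trans ((le_abs_self _).trans (hPx _ _))
  · intro x
    have := hnn x
    have h2 := PhiF_nonneg g y (P x)
    simp only [hθ] at this
    linarith
  · intro x
    rw [hasFDerivAt_iff_isLittleO_nhds_zero, Asymptotics.isLittleO_iff]
    intro c hc
    obtain ⟨δ, hδ, H⟩ := strong_max g hg y hy hgy x (P x) (hP x) (hmax x) (c / 11) (by positivity)
    filter_upwards [Metric.ball_mem_nhds (0 : X) (half_pos hδ)] with h hh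
    rw [mem_ball_zero_iff] at hh
    have h1 := hsub (x + h) x
    have h2 := hsub x (x + h)
    rw [add_sub_cancel_left] at h1
    have e : x - (x + h) = - h := by abel
    rw [e, map_neg] at h2
    have h3 := H (P (x + h)) (hP _) (by
      have a1 := abs_le.1 (hPx (x + h) h)
      have a2 := abs_le.1 (hPx x h)
      have : P (x + h) x - PhiF g y (P (x + h)) = θ (x + h) - P (x + h) h := by
        simp only [hθ, map_add]; ring
      rw [this]
      have : P x x - PhiF g y (P x) = θ x := rfl
      rw [this]
      linarith)
    have h4 := (P (x + h) - P x).le_opNorm h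
    rw [Real.norm_eq_abs, sub_apply] at h4
    have h5 := le_abs_self (P (x + h) h - P x h)
    have h6 : ‖P (x + h) - P x‖ * ‖h‖ ≤ c * ‖h‖ := by
      gcongr; linarith
    rw [Real.norm_eq_abs, abs_le]
    constructor <;> nlinarith [norm_nonneg h]
  · intro r hr
    set t := min 1 (r / 8) with ht
    have ht0 : 0 < t := by positivity
    have ht1 : t ≤ 1 := min_le_left _ _
    have ht8 : t ≤ r / 8 := min_le_right _ _
    refine ⟨t * r - 4 * t^2, by nlinarith, fun x hx => ?_⟩
    by_contra! hxr
    obtain ⟨q, hq, hqx⟩ := exists_dual_vector'' ℝ x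
    have := hlow x (t • q) (by
      rw [norm_smul, Real.norm_eq_abs, abs_of_pos ht0]; nlinarith [norm_nonneg q])
    rw [norm_smul, Real.norm_eq_abs, abs_of_pos ht0, smul_apply, hqx] at this
    simp only [smul_eq_mul, RCLike.ofReal_real_eq_id, id] at this
    have h1 : (t * ‖q‖)^2 ≤ t^2 := by
      rw [mul_pow]; nlinarith [norm_nonneg q, sq_nonneg t, mul_nonneg (sq_nonneg t) (norm_nonneg q), pow_le_one₀ (n := 2) (norm_nonneg q) hq]
    nlinarith

end Theta

section BP

variable {X : Type*} [NormedAddCommGroup X] [NormedSpace ℝ X]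

/-- smooth variational principle -/
theorem smooth_vp_s5 [CompleteSpace X] {θ : X → ℝ} {P : X → StrongDual ℝ X} (hθ : SmoothGauge θ P)
    (F : X → ℝ) (hF : LowerSemicontinuous F) (m : ℝ) (hm : ∀ x, m ≤ F x)
    (a : X) (ε : ℝ) (hε : 0 < ε) :
    ∃ (u : X) (ψ : X → ℝ) (ψ' : StrongDual ℝ X), F u ≤ F a ∧ HasFDerivAt ψ ψ' u ∧ ‖ψ'‖ ≤ ε ∧
      ∀ x, F u + ψ u ≤ F x + ψ x := by
  classical
  have hθc : Continuous θ := continuous_iff_continuousAt.2 fun x => (hθ.deriv x).continuousAt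
  set μ : ℕ → ℝ := fun n => ε / 2 * (1/2)^n with hμ
  have hμ0 : ∀ n, 0 < μ n := fun n => by simp only [hμ]; positivity
  have hμsum : HasSum μ ε := by
    have := (hasSum_geometric_of_lt_one (r := (1/2 : ℝ)) (by norm_num) (by norm_num)).mul_left (ε/2)
    have e : ε / 2 * (1 - 1 / 2)⁻¹ = ε := by norm_num
    rw [e] at this
    exact this
  -- one step of the construction
  have step : ∀ (G : X → ℝ) (z : X) (η : ℝ), 0 < η → (∀ x, m ≤ G x) →
      ∃ z', G z' ≤ G z ∧ ∀ x, G z' ≤ G x + η := by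
    intro G z η hη hG
    have hbdd : BddBelow (Set.range G) := ⟨m, by rintro _ ⟨x, rfl⟩; exact hG x⟩
    have : Nonempty X := ⟨z⟩
    obtain ⟨w, hw⟩ := exists_lt_of_ciInf_lt (lt_add_of_pos_right (⨅ x, G x) hη)
    rcases le_total (G w) (G z) with h | h
    · exact ⟨w, h, fun x => hw.le.trans (by linarith [ciInf_le hbdd x])⟩
    · exact ⟨z, le_rfl, fun x => h.trans (hw.le.trans (by linarith [ciInf_le hbdd x]))⟩
  choose! nxt hn1 hn2 using step
  -- states: pair of a function and a point
  let η : ℕ → ℝ := fun n => μ n * (1/2)^n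
  have hη0 : ∀ n, 0 < η n := fun n => mul_pos (hμ0 n) (by positivity)
  let st : ℕ → (X → ℝ) × X := fun n => Nat.rec (F, a)
    (fun n s => (fun x => s.1 x + μ n * θ (x - s.2),
      nxt (fun x => s.1 x + μ n * θ (x - s.2)) s.2 (η (n+1)))) n
  set G : ℕ → X → ℝ := fun n => (st n).1 with hG
  set w : ℕ → X := fun n => (st n).2 with hw
  have G0 : G 0 = F := rfl
  have w0 : w 0 = a := rfl
  have Gs : ∀ n x, G (n+1) x = G n x + μ n * θ (x - w n) := fun n x => rfl
  have ws : ∀ n, w (n+1) = nxt (G (n+1)) (w n) (η (n+1)) := fun n => rfl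
  have Gmono : ∀ n x, G n x ≤ G (n+1) x := fun n x => by
    rw [Gs]; linarith [mul_nonneg (hμ0 n).le (hθ.nonneg (x - w n))]
  have Gm : ∀ n x, m ≤ G n x := by
    intro n
    induction n with
    | zero => exact hm
    | succ n ih => exact fun x => (ih x).trans (Gmono n x)
  have Glsc : ∀ n, LowerSemicontinuous (G n) := by
    intro n
    induction n with
    | zero => exact hF
    | succ n ih =>
      exact ih.add (Continuous.lowerSemicontinuous (by fun_prop))
  have Gw : ∀ n, G (n+1) (w n) = G n (w n) := fun n => by rw [Gs]; simp [hθ.zero]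
  have w1 : ∀ n, G (n+1) (w (n+1)) ≤ G n (w n) := fun n => by
    rw [← Gw n, ws]; exact hn1 _ _ _ (hη0 (n+1)) (Gm (n+1))
  have w2 : ∀ n x, G (n+1) (w (n+1)) ≤ G (n+1) x + η (n+1) := fun n x => by
    rw [ws]; exact hn2 _ _ _ (hη0 (n+1)) (Gm (n+1)) x
  let S : ℕ → Set X := fun n => {x | G (n+1) x ≤ G n (w n)}
  have Smem : ∀ n, w n ∈ S n := fun n => (Gw n).le
  have Ssub : ∀ n, S (n+1) ⊆ S n := by
    intro n x hx
    have hx' : G (n+1+1) x ≤ G (n+1) (w (n+1)) := hx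
    show G (n+1) x ≤ G n (w n)
    exact (Gmono (n+1) x).trans (hx'.trans (w1 n))
  have Santi : Antitone S := antitone_nat_of_succ_le Ssub
  have Sclosed : ∀ n, IsClosed (S n) := fun n => (Glsc (n+1)).isClosed_preimage _
  have Sθ : ∀ n x, x ∈ S (n+1) → θ (x - w (n+1)) ≤ (1/2)^(n+1) := by
    intro n x hx
    have h1 : G (n+1) x + μ (n+1) * θ (x - w (n+1)) ≤ G (n+1) (w (n+1)) := hx
    have h2 := w2 n x
    have h3 : μ (n+1) * θ (x - w (n+1)) ≤ μ (n+1) * (1/2)^(n+1) := by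
      have : η (n+1) = μ (n+1) * (1/2)^(n+1) := rfl
      linarith
    exact le_of_mul_le_mul_left h3 (hμ0 _)
  have Ssmall : ∀ r > 0, ∃ n, ∀ x ∈ S n, ‖x - w n‖ < r := by
    intro r hr
    obtain ⟨κ, hκ, H⟩ := hθ.sep r hr
    obtain ⟨n, hn⟩ := exists_pow_lt_of_lt_one hκ (show (1/2 : ℝ) < 1 by norm_num)
    refine ⟨n+1, fun x hx => H _ ((Sθ n x hx).trans_lt (lt_of_le_of_lt ?_ hn))⟩
    exact pow_le_pow_of_le_one (by norm_num) (by norm_num) (Nat.le_succ n)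
  have wmem : ∀ n k, n ≤ k → w k ∈ S n := fun n k h => Santi h (Smem k)
  have hcau : CauchySeq w := by
    rw [Metric.cauchySeq_iff']
    intro r hr
    obtain ⟨n, hn⟩ := Ssmall r hr
    exact ⟨n, fun k hk => by rw [dist_eq_norm]; exact hn _ (wmem n k hk)⟩
  obtain ⟨u, hu⟩ := cauchySeq_tendsto_of_complete hcau
  have uS : ∀ n, u ∈ S n := fun n => (Sclosed n).mem_of_tendsto hu
    (eventually_atTop.2 ⟨n, fun k hk => wmem n k hk⟩)
  have hθle : ∀ x, θ x ≤ ‖x‖ := fun x => by simpa [hθ.zero] using hθ.lip x 0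
  -- bound on w
  obtain ⟨B, hB⟩ := hcau.isBounded_range.exists_norm_le
  have hB' : ∀ n, ‖w n‖ ≤ B := fun n => hB _ ⟨n, rfl⟩
  have hsum : ∀ x, Summable fun n => μ n * θ (x - w n) := by
    intro x
    refine Summable.of_nonneg_of_le (fun n => mul_nonneg (hμ0 n).le (hθ.nonneg _)) (fun n => ?_)
      (hμsum.summable.mul_right (‖x‖ + B))
    have : θ (x - w n) ≤ ‖x‖ + B := (hθle _).trans ((norm_sub_le _ _).trans (by linarith [hB' n]))
    exact mul_le_mul_of_nonneg_left this (hμ0 n).le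
  have Gsum : ∀ n x, G n x = F x + ∑ k ∈ Finset.range n, μ k * θ (x - w k) := by
    intro n x
    induction n with
    | zero => simp [G0]
    | succ n ih => rw [Gs, ih, Finset.sum_range_succ]; ring
  have hder : ∀ n x, HasFDerivAt (fun x => μ n * θ (x - w n)) (μ n • P (x - w n)) x := by
    intro n x
    have h1 : HasFDerivAt (fun x => θ (x - w n)) (P (x - w n)) x := by
      have := (hθ.deriv (x - w n)).comp x ((hasFDerivAt_id x).sub_const (w n))
      rw [ContinuousLinearMap.comp_id] at this
      exact this
    exact h1.const_mul (μ n)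
  have hnorm : ∀ n x, ‖μ n • P (x - w n)‖ ≤ μ n := by
    intro n x
    rw [norm_smul, Real.norm_eq_abs, abs_of_pos (hμ0 n)]
    exact mul_le_of_le_one_right (hμ0 n).le (hθ.P_le _)
  refine ⟨u, fun x => ∑' n, μ n * θ (x - w n), ∑' n, μ n • P (u - w n), ?_, ?_, ?_, ?_⟩
  · exact (Gmono 0 u).trans (uS 0)
  · exact hasFDerivAt_tsum hμsum.summable hder hnorm (hsum 0) u
  · exact tsum_of_norm_bounded hμsum fun n => hnorm n u
  · intro x
    have hlim : ∀ z, Tendsto (fun n => G n z) atTop (𝓝 (F z + ∑' n, μ n * θ (z - w n))) := by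
      intro z
      simp_rw [Gsum]
      exact tendsto_const_nhds.add (hsum z).hasSum.tendsto_sum_nat
    have hη : Tendsto (fun n => η (n+1)) atTop (𝓝 0) := by
      have h1 : Tendsto μ atTop (𝓝 0) := hμsum.summable.tendsto_atTop_zero
      have h2 : Tendsto (fun n : ℕ => (1/2 : ℝ)^n) atTop (𝓝 0) :=
        tendsto_pow_atTop_nhds_zero_of_lt_one (by norm_num) (by norm_num)
      have h3 := h1.mul h2
      rw [mul_zero] at h3
      exact h3.comp (tendsto_add_atTop_nat 1)
    have l1 := (hlim u).comp (tendsto_add_atTop_nat 2)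
    have l2 := ((hlim x).comp (tendsto_add_atTop_nat 1)).add hη
    rw [add_zero] at l2
    refine le_of_tendsto_of_tendsto' l1 l2 fun n => ?_
    exact (uS (n+1)).trans (w2 n x)

end BP

section MVT

variable {X : Type*} [NormedAddCommGroup X] [NormedSpace ℝ X]

lemma exists_clamp (f : X → EReal) (hf : LowerSemicontinuous f) (m M : ℝ) (_hmM : m ≤ M) :
    ∃ g : X → ℝ, LowerSemicontinuous g ∧ ∀ x, (g x : EReal) = max (min (f x) M) m := by
  refine ⟨fun x => (max (min (f x) M) m : EReal).toReal, ?_, ?_⟩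
  swap
  · intro x
    refine EReal.coe_toReal ?_ ?_
    · refine (max_lt ((min_le_right _ _).trans_lt (EReal.coe_lt_top M)) (EReal.coe_lt_top m)).ne
    · exact ((EReal.bot_lt_coe m).trans_le (le_max_right _ _)).ne'
  · rw [lowerSemicontinuous_iff_isClosed_preimage]
    intro c
    have : (fun x => (max (min (f x) M) m : EReal).toReal) ⁻¹' Set.Iic c =
        {x | (M : EReal) ≤ c ∧ (m : EReal) ≤ c} ∪ ({x | f x ≤ (c : EReal)} ∩ {x | (m : EReal) ≤ c}) := by
      ext x
      have e : ((max (min (f x) M) m : EReal).toReal : EReal) = max (min (f x) M) m := by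
        refine EReal.coe_toReal ?_ ?_
        · refine (max_lt ((min_le_right _ _).trans_lt (EReal.coe_lt_top M)) (EReal.coe_lt_top m)).ne
        · exact ((EReal.bot_lt_coe m).trans_le (le_max_right _ _)).ne'
      simp only [Set.mem_preimage, Set.mem_Iic, Set.mem_union, Set.mem_inter_iff, Set.mem_ofPred_eq]
      rw [← EReal.coe_le_coe_iff, e, max_le_iff, min_le_iff]
      tauto
    rw [this]
    refine IsClosed.union isClosed_const (IsClosed.inter ?_ isClosed_const)
    exact hf.isClosed_preimage _

set_option maxHeartbeats 2000000 in
theorem mvt [CompleteSpace X] {θ : X → ℝ} {P : X → StrongDual ℝ X} (hθ : SmoothGauge θ P)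
    (f : X → EReal) (hf : LowerSemicontinuous f) (hbot : ∀ x, f x ≠ ⊥)
    (a b : X) (κ : ℝ) (hκ : 0 ≤ κ) (hab : f a < f b) (r : ℝ) (hr : 0 < r) :
    ∃ (u : X) (us : X →L[ℝ] ℝ), us ∈ FrechetSubdiff f u ∧
      (∃ s : ℝ, 0 ≤ s ∧ s < 1 ∧ ‖u - (a + s • (b - a))‖ < r) ∧
      0 < us (b + κ • (b - a) - u) := by
  have hfa : f a ≠ ⊤ := (hab.trans_le le_top).ne
  set α := (f a).toReal with hα
  have hαc : f a = (α : EReal) := (EReal.coe_toReal hfa (hbot a)).symm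
  have hab0 : b ≠ a := by rintro rfl; exact lt_irrefl _ hab
  have hd : 0 < ‖b - a‖ := norm_pos_iff.2 (sub_ne_zero.2 hab0)
  obtain ⟨β, hβ1, hβ2⟩ := EReal.lt_iff_exists_real_btwn.1 hab
  set ρ := β - α with hρ
  have hρ0 : 0 < ρ := by
    rw [hαc, EReal.coe_lt_coe_iff] at hβ1; simp only [hρ]; linarith
  have hβ : β = α + ρ := by simp only [hρ]; ring
  -- ball around b
  obtain ⟨r1, hr1, hball⟩ := Metric.eventually_nhds_iff.1 (hf b β hβ2)
  -- lower bound near the segment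
  set c : ℝ → X := fun s => a + s • (b - a) with hc
  have hcc : Continuous c := by fun_prop
  have hK : IsCompact (c '' Set.Icc 0 1) := isCompact_Icc.image hcc
  have hKne : (c '' Set.Icc 0 1).Nonempty := ⟨c 0, 0, by simp, rfl⟩
  obtain ⟨x0, hx0, hx0min⟩ := LowerSemicontinuousOn.exists_isMinOn hKne hK (hf.lowerSemicontinuousOn _)
  obtain ⟨m, _, hm⟩ := EReal.lt_iff_exists_real_btwn.1 (bot_lt_iff_ne_bot.2 (hbot x0))
  obtain ⟨r2, hr2, hthick⟩ := hK.exists_thickening_subset_open (hf.isOpen_preimage (m : EReal))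
    (fun x hx => lt_of_lt_of_le hm (hx0min hx))
  have hlow : ∀ s ∈ Set.Icc (0:ℝ) 1, ∀ w, ‖w - c s‖ < r2 → (m : EReal) < f w := by
    intro s hs w hw
    exact hthick (Metric.mem_thickening_iff.2 ⟨c s, ⟨s, hs, rfl⟩, by rwa [dist_eq_norm]⟩)
  have hmα : m < α := by
    have := hlow 0 (by simp) a (by simp [hc, hr2])
    rwa [hαc, EReal.coe_lt_coe_iff] at this
  obtain ⟨g, hg, hgf⟩ := exists_clamp f hf m (α + ρ + 1) (by linarith)
  have hgm : ∀ x, m ≤ g x := fun x => by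
    rw [← EReal.coe_le_coe_iff, hgf]; exact le_max_right _ _
  have hgα : g a ≤ α := by
    rw [← EReal.coe_le_coe_iff, hgf, hαc]
    exact max_le (min_le_left _ _) (by exact_mod_cast hmα.le)
  set r3 := min r (min r2 (r1 / 2)) with hr3
  have hr30 : 0 < r3 := by positivity
  have hr3r : r3 ≤ r := min_le_left _ _
  have hr32 : r3 ≤ r2 := (min_le_right _ _).trans (min_le_left _ _)
  have hr31 : r3 ≤ r1 / 2 := (min_le_right _ _).trans (min_le_right _ _)
  obtain ⟨k, hk0, hk⟩ := hθ.sep r3 hr30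
  -- penalization constant
  set N := (α + ρ - m + 1) / k with hN
  have hN0 : 0 < N := by apply div_pos _ hk0; linarith
  have hNk : N * k = α + ρ - m + 1 := by simp only [hN]; field_simp
  have hθc : Continuous θ := continuous_iff_continuousAt.2 fun x => (hθ.deriv x).continuousAt
  have hmin : ∀ w : X, ∃ s ∈ Set.Icc (0:ℝ) 1, ∀ t ∈ Set.Icc (0:ℝ) 1,
      -ρ * s + N * θ (w - c s) ≤ -ρ * t + N * θ (w - c t) := by
    intro w
    obtain ⟨s, hs, hs2⟩ := isCompact_Icc.exists_isMinOn (s := Set.Icc (0:ℝ) 1)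
      ⟨0, by simp⟩ (f := fun s => -ρ * s + N * θ (w - c s)) (by fun_prop)
    exact ⟨s, hs, fun t ht => hs2 ht⟩
  choose σ hσ hσmin using hmin
  set h : X → ℝ := fun w => -ρ * σ w + N * θ (w - c (σ w)) with hh
  have hle : ∀ w, ∀ t ∈ Set.Icc (0:ℝ) 1, h w ≤ -ρ * t + N * θ (w - c t) := hσmin
  have hlip : LipschitzWith N.toNNReal h := by
    refine LipschitzWith.of_le_add_mul _ fun x y => ?_
    rw [Real.coe_toNNReal _ hN0.le, dist_eq_norm]
    have h1 := hle x (σ y) (hσ y)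
    have h2 := hθ.lip (x - c (σ y)) (y - c (σ y))
    rw [sub_sub_sub_cancel_right] at h2
    have h3 := mul_le_mul_of_nonneg_left h2 hN0.le
    simp only [hh] at h1 ⊢
    linarith
  have hhρ : ∀ w, -ρ ≤ h w := by
    intro w
    have h1 := mul_nonneg hN0.le (hθ.nonneg (w - c (σ w)))
    have h2 := (hσ w).2
    simp only [hh]
    nlinarith
  have hha : h a ≤ 0 := by
    have := hle a 0 (by simp)
    simpa [hc, hθ.zero] using this
  -- perturbation size
  set R := ‖b + κ • (b - a) - a‖ + ‖b - a‖ + r3 with hR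
  have hR0 : 0 < R := by positivity
  set ε := ρ * r1 / (2 * ‖b - a‖) / (2 * R) with hε
  have hε0 : 0 < ε := by positivity
  obtain ⟨u, ψ, ψ', hu1, hψ, hψε, hu2⟩ := smooth_vp_s5 hθ (fun x => g x + h x)
    (hg.add hlip.continuous.lowerSemicontinuous) (m - ρ) (fun x => by linarith [hgm x, hhρ x])
    a ε hε0
  set s := σ u with hs
  set q := u - c s with hq
  have hs01 := hσ u
  have hu3 : g u + N * θ q ≤ α + ρ * s := by
    have : h u = -ρ * s + N * θ q := rfl
    linarith
  have hq3 : ‖q‖ < r3 := by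
    apply hk
    have : N * θ q < N * k := by
      rw [hNk]; nlinarith [hgm u, hs01.2]
    exact lt_of_mul_lt_mul_left this hN0.le
  have hgu : g u ≤ α + ρ := by
    nlinarith [mul_nonneg hN0.le (hθ.nonneg q), hs01.2]
  have hmu : (m : EReal) < f u := hlow s hs01 u (hq3.trans_le hr32)
  have hfu : f u = (g u : EReal) := by
    have h1 := hgf u
    rcases le_total (f u) ((α + ρ + 1 : ℝ) : EReal) with h2 | h2
    · rw [min_eq_left h2, max_eq_left hmu.le] at h1
      exact h1.symm
    · rw [min_eq_right h2, max_eq_left (by exact_mod_cast (by linarith))] at h1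
      have : g u = α + ρ + 1 := by exact_mod_cast h1
      linarith
  have hs1 : r1 / 2 ≤ (1 - s) * ‖b - a‖ := by
    by_contra! hlt
    have h1 : dist u b < r1 := by
      have e : u - b = q - (1 - s) • (b - a) := by
        simp only [hq, hc]; module
      rw [dist_eq_norm, e]
      refine (norm_sub_le _ _).trans_lt ?_
      rw [norm_smul, Real.norm_eq_abs, abs_of_nonneg (by linarith [hs01.2])]
      linarith
    have h2 : (β : EReal) < f u := hball h1
    rw [hfu, EReal.coe_lt_coe_iff] at h2
    linarith
  have hs1' : s < 1 := by
    by_contra! h1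
    have : (1 - s) * ‖b - a‖ ≤ 0 := mul_nonpos_of_nonpos_of_nonneg (by linarith) hd.le
    linarith
  -- derivative in s
  have hPd : N * P q (b - a) ≤ -ρ := by
    have hder : HasDerivAt (fun t : ℝ => N * θ (q - t • (b - a))) (N * P q (-(b - a))) 0 := by
      have h1 : HasDerivAt (fun t : ℝ => q - t • (b - a)) (-(b - a)) 0 := by
        simpa using ((hasDerivAt_id (0:ℝ)).smul_const (b - a)).const_sub q
      have h2 : HasFDerivAt θ (P q) (q - (0:ℝ) • (b - a)) := by simpa using hθ.deriv q
      exact (h2.comp_hasDerivAt (0:ℝ) h1).const_mul N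
    have hslope := hder.tendsto_slope_zero_right
    have : ρ ≤ N * P q (-(b - a)) := by
      refine ge_of_tendsto hslope ?_
      have : Set.Ioo (0:ℝ) (1 - s) ∈ 𝓝[>] (0:ℝ) := Ioo_mem_nhdsGT (by linarith)
      filter_upwards [this] with t ht
      have h1 := hle u (s + t) ⟨by linarith [hs01.1, ht.1], by linarith [ht.2]⟩
      have e1 : h u = -ρ * s + N * θ q := rfl
      have e2 : u - c (s + t) = q - t • (b - a) := by simp only [hq, hc]; module
      rw [e1, e2] at h1
      simp only [zero_add, zero_smul, sub_zero, smul_eq_mul]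
      rw [inv_mul_eq_div, le_div_iff₀ ht.1]
      linarith
    rw [map_neg] at this
    linarith
  refine ⟨u, -(N • P q) - ψ', ⟨?_, ?_⟩, ⟨s, hs01.1, hs1', hq3.trans_le hr3r⟩, ?_⟩
  · rw [hfu]; exact EReal.coe_ne_top _
  · intro η hη
    -- the smooth minorant
    have hD : HasFDerivAt (fun w => N * θ (w - c s) + ψ w) (N • P q + ψ') u := by
      have h1 : HasFDerivAt (fun x => θ (x - c s)) (P q) u := by
        have := (hθ.deriv (u - c s)).comp u ((hasFDerivAt_id u).sub_const (c s))
        rw [ContinuousLinearMap.comp_id] at this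
        exact this
      exact (h1.const_mul N).add hψ
    have hlo := (hasFDerivAt_iff_isLittleO.1 hD).def hη
    have hnear : ∀ᶠ w in 𝓝 u, (m : EReal) < f w := hf u m hmu
    filter_upwards [hlo, hnear] with w hw hmw
    have hgw : (g w : EReal) ≤ f w := by
      rw [hgf]; exact max_le (min_le_left _ _) hmw.le
    refine le_trans ?_ hgw
    rw [hfu]
    have h1 := hu2 w
    have h2 := hle w s hs01
    have e1 : h u = -ρ * s + N * θ q := rfl
    rw [Real.norm_eq_abs] at hw
    have h3 := (abs_le.1 hw).2
    simp only [add_apply, smul_apply, smul_eq_mul] at h3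
    have : g u + (-(N • P q) - ψ') (w - u) - η * ‖w - u‖ ≤ g w := by
      simp only [sub_apply, neg_apply, smul_apply, smul_eq_mul]
      have e3 : θ (u - c s) = θ q := rfl
      rw [e3] at h3
      linarith
    exact_mod_cast this
  · have e : b + κ • (b - a) - u = (1 + κ - s) • (b - a) - q := by
      simp only [hq, hc]; module
    have hnorm : ‖b + κ • (b - a) - u‖ ≤ R := by
      have : b + κ • (b - a) - u = (b + κ • (b - a) - a) - s • (b - a) - q := by
        simp only [hq, hc]; module
      rw [this]
      refine (norm_sub_le _ _).trans ((add_le_add (norm_sub_le _ _) le_rfl).trans ?_)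
      rw [norm_smul, Real.norm_eq_abs, abs_of_nonneg hs01.1]
      nlinarith
    have h1 : |ψ' (b + κ • (b - a) - u)| ≤ ε * R := by
      refine (ψ'.le_opNorm _).trans ?_
      gcongr
    have h2 : ε * R = ρ * r1 / (2 * ‖b - a‖) / 2 := by
      simp only [hε]; field_simp
    have h3 : r1 / (2 * ‖b - a‖) ≤ 1 - s := by
      rw [div_le_iff₀ (by positivity)]; linarith
    have h4 : ρ * r1 / (2 * ‖b - a‖) ≤ ρ * (1 - s) := by
      rw [mul_div_assoc]; gcongr
    have h5 : 0 < ρ * r1 / (2 * ‖b - a‖) := by positivity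
    have h6 : (N • P q) (b + κ • (b - a) - u) = (1 + κ - s) * (N * P q (b - a)) - N * P q q := by
      have e6 : ∀ z, (N • P q) z = N * P q z := fun z => rfl
      rw [e6, e, map_sub, map_smul, smul_eq_mul]; ring
    have h7 := mul_nonneg hN0.le (hθ.P_self q)
    have h8 : (1 + κ - s) * (N * P q (b - a)) ≤ (1 + κ - s) * (-ρ) :=
      mul_le_mul_of_nonneg_left hPd (by linarith)
    have h9 : (1 + κ - s) * (-ρ) ≤ - (ρ * (1 - s)) := by nlinarith
    have h10 : (-(N • P q) - ψ') (b + κ • (b - a) - u) =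
      - ((N • P q) (b + κ • (b - a) - u)) - ψ' (b + κ • (b - a) - u) := rfl
    rw [h10, h6]
    linarith [(abs_le.1 h1).2]

end MVT

section QuasiMono

variable {X : Type*} [NormedAddCommGroup X] [NormedSpace ℝ X]

theorem quasiconvex_of_quasimonotone_aux [CompleteSpace X] {θ : X → ℝ} {P : X → StrongDual ℝ X}
    (hθ : SmoothGauge θ P)
    (f : X → EReal) (hf : LowerSemicontinuous f) (hbot : ∀ x, f x ≠ ⊥)
    (hmono : ∀ x y : X, ∀ xs ∈ FrechetSubdiff f x, ∀ ys ∈ FrechetSubdiff f y,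
        min (xs (y - x)) (ys (x - y)) ≤ 0) : QuasiconvexFn f := by
  intro x y l hl0 hl1
  by_contra! hlt
  obtain ⟨hx, hy⟩ := max_lt_iff.1 hlt
  set z := l • x + (1 - l) • y with hz
  have h1l : 0 < 1 - l := by linarith
  obtain ⟨r, hr, hball⟩ := Metric.eventually_nhds_iff.1 (hf z (f y) hy)
  obtain ⟨u, us, hus, ⟨s, hs0, hs1, hsr⟩, hpos⟩ := mvt hθ f hf hbot x z (l / (1 - l))
    (by positivity) hx r hr
  have e1 : z + (l / (1 - l)) • (z - x) = y := by
    have : z - x = (1 - l) • (y - x) := by rw [hz]; module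
    rw [this, smul_smul, div_mul_cancel₀ _ h1l.ne', hz]; module
  rw [e1] at hpos
  have hD : 0 < 1 - s * (1 - l) := by nlinarith
  set τ := (1 - l) * (1 - s) / (1 - s * (1 - l)) with hτ
  have hτ0 : 0 < τ := div_pos (mul_pos h1l (by linarith)) hD
  have hτ1 : τ < 1 := by rw [hτ, div_lt_one hD]; nlinarith
  have hτD : τ * (1 - s * (1 - l)) = (1 - l) * (1 - s) := div_mul_cancel₀ _ hD.ne'
  set c := x + s • (z - x) with hc
  have ec : c + τ • (y - c) = z := by
    have h1 : c = x + (s * (1 - l)) • (y - x) := by rw [hc, hz]; module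
    have h2 : y - c = (1 - s * (1 - l)) • (y - x) := by rw [h1]; module
    rw [h2, smul_smul, hτD, h1, hz]; module
  set z' := u + τ • (y - u) with hz'
  have ez : z' - z = (1 - τ) • (u - c) := by rw [← ec, hz']; module
  have hz1 : f y < f z' := by
    apply hball
    rw [dist_eq_norm, ez, norm_smul, Real.norm_eq_abs, abs_of_pos (by linarith)]
    nlinarith [norm_nonneg (u - c)]
  set A := us (y - u) with hA
  have h1τ : 0 < 1 - τ := by linarith
  obtain ⟨v, vs, hvs, ⟨t, ht0, ht1, htr⟩, hpos2⟩ := mvt hθ f hf hbot y z' (τ / (1 - τ))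
    (by positivity) hz1 (τ * A / (‖us‖ + 1)) (by positivity)
  have e2 : z' + (τ / (1 - τ)) • (z' - y) = u := by
    have : z' - y = (1 - τ) • (u - y) := by rw [hz']; module
    rw [this, smul_smul, div_mul_cancel₀ _ h1τ.ne', hz']; module
  rw [e2] at hpos2
  have hpos1 : 0 < us (v - u) := by
    set w := v - (y + t • (z' - y)) with hw
    have e3 : v - u = w + (1 - t * (1 - τ)) • (y - u) := by rw [hw, hz']; module
    have h1 : |us w| ≤ ‖us‖ * ‖w‖ := us.le_opNorm w
    rw [lt_div_iff₀ (by positivity)] at htr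
    have h2 : ‖us‖ * ‖w‖ < τ * A := by nlinarith [norm_nonneg w, norm_nonneg us]
    have h3 : τ * A ≤ (1 - t * (1 - τ)) * A := by
      apply mul_le_mul_of_nonneg_right _ hpos.le; nlinarith
    rw [e3, map_add, map_smul, smul_eq_mul]
    linarith [(abs_le.1 h1).1]
  exact absurd (hmono u v us hus vs hvs) (not_le.2 (lt_min hpos1 hpos2))

end QuasiMono

section SepRed

variable {X : Type*} [NormedAddCommGroup X] [NormedSpace ℝ X]

/-- The subspace `Y` reflects finite configurations of `X` (with respect to `f`). -/
def Reflects (f : X → EReal) (Y : Submodule ℝ X) : Prop :=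
  ∀ (G : Finset X) (η : ℝ), 0 < η → ∃ L : X → Y,
    (∀ x ∈ G, ∀ u : Y, (u : X) ∈ G → |‖(L x : X) - u‖ - ‖x - u‖| ≤ η) ∧
    (∀ x ∈ G, ∀ y ∈ G, x + y ∈ G → ‖(L (x + y) : X) - L x - L y‖ ≤ η) ∧
    (∀ x ∈ G, f x ≠ ⊤ → f (L x) ≤ f x + (η : EReal))

theorem Reflects.extend {f : X → EReal} (hbot : ∀ x, f x ≠ ⊥) {Y : Submodule ℝ X}
    (hY : Reflects f Y) (u : Y) (p : StrongDual ℝ Y)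
    (hp : p ∈ FrechetSubdiff (fun y : Y => f y) u) :
    ∃ q : StrongDual ℝ X, q ∈ FrechetSubdiff f (u : X) ∧ ∀ y : Y, q y = p y := by
  classical
  have hpos : ∀ i : Finset X × ℕ, (0:ℝ) < 1 / ((i.2 : ℝ) + 1) := fun i => by positivity
  choose L hL1 hL2 hL3 using fun i : Finset X × ℕ => hY i.1 _ (hpos i)
  let U : Ultrafilter (Finset X × ℕ) := Ultrafilter.of atTop
  have hU : (U : Filter (Finset X × ℕ)) ≤ atTop := Ultrafilter.of_le atTop
  have hη : Tendsto (fun i : Finset X × ℕ => 1 / ((i.2 : ℝ) + 1)) U (𝓝 0) := by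
    refine Tendsto.mono_left ?_ hU
    refine tendsto_one_div_add_atTop_nhds_zero_nat.comp ?_
    rw [← prod_atTop_atTop_eq]; exact tendsto_snd
  have hmem : ∀ x : X, ∀ᶠ i in (U : Filter (Finset X × ℕ)), x ∈ i.1 := by
    intro x
    refine hU ?_
    filter_upwards [eventually_ge_atTop (({x} : Finset X), 0)] with i hi
    exact hi.1 (Finset.mem_singleton_self x)
  -- convergence of the distances
  have hdist : ∀ (x : X) (w : Y), Tendsto (fun i => ‖L i x - w‖) U (𝓝 ‖x - w‖) := by
    intro x w
    rw [tendsto_iff_dist_tendsto_zero]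
    refine squeeze_zero' (Eventually.of_forall fun i => dist_nonneg) ?_ hη
    filter_upwards [hmem x, hmem w] with i h1 h2
    exact hL1 i x h1 w h2
  have hex : ∀ x : X, ∃ c : ℝ, Tendsto (fun i => p (L i x)) U (𝓝 c) := by
    intro x
    have hev : ∀ᶠ i in (U : Filter (Finset X × ℕ)),
        p (L i x) ∈ Set.Icc (-(‖p‖ * (‖x‖ + 1))) (‖p‖ * (‖x‖ + 1)) := by
      have h1 := hdist x 0
      simp only [sub_zero, ZeroMemClass.coe_zero] at h1
      filter_upwards [h1.eventually (gt_mem_nhds (lt_add_one ‖x‖))] with i hi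
      rw [Set.mem_Icc, ← abs_le, ← Real.norm_eq_abs]
      exact (p.le_opNorm _).trans (by gcongr)
    obtain ⟨c, -, hc⟩ := (isCompact_Icc (a := -(‖p‖ * (‖x‖ + 1)))
      (b := ‖p‖ * (‖x‖ + 1))).ultrafilter_le_nhds (U.map fun i => p (L i x)) (by
        rw [le_principal_iff]; exact hev)
    exact ⟨c, hc⟩
  choose q hq using hex
  have hadd : ∀ x y, q (x + y) = q x + q y := by
    intro x y
    have h0 : Tendsto (fun i => p (L i (x + y) - L i x - L i y)) U (𝓝 0) := by
      have h1 : Tendsto (fun i => L i (x + y) - L i x - L i y) U (𝓝 0) := by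
        rw [tendsto_zero_iff_norm_tendsto_zero]
        refine squeeze_zero' (Eventually.of_forall fun i => norm_nonneg _) ?_ hη
        filter_upwards [hmem x, hmem y, hmem (x + y)] with i h1 h2 h3
        exact hL2 i x h1 y h2 h3
      have := (p.continuous.tendsto 0).comp h1
      rw [map_zero] at this
      exact this
    have h2 := ((hq (x + y)).sub (hq x)).sub (hq y)
    have h3 : Tendsto (fun i => p (L i (x + y)) - p (L i x) - p (L i y)) U (𝓝 0) := by
      simpa only [map_sub] using h0
    have := tendsto_nhds_unique h2 h3
    linarith
  have hbd : ∀ x, ‖q x‖ ≤ ‖p‖ * ‖x‖ := by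
    intro x
    have h1 := hdist x 0
    simp only [sub_zero, ZeroMemClass.coe_zero] at h1
    exact le_of_tendsto_of_tendsto (hq x).norm (h1.const_mul ‖p‖)
      (Eventually.of_forall fun i => p.le_opNorm _)
  have hqY : ∀ y : Y, q y = p y := by
    intro y
    have h1 := hdist y y
    rw [sub_self, norm_zero, ← tendsto_iff_norm_sub_tendsto_zero] at h1
    exact tendsto_nhds_unique (hq y) ((p.continuous.tendsto y).comp h1)
  let Q0 : X →+ ℝ := AddMonoidHom.mk' q hadd
  let Q : StrongDual ℝ X := Q0.toRealLinearMap
    (AddMonoidHomClass.continuous_of_bound Q0 ‖p‖ hbd)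
  have hQ : ∀ x, Q x = q x := fun x => rfl
  refine ⟨Q, ⟨hp.1, ?_⟩, fun y => hqY y⟩
  intro ε hε
  obtain ⟨δ, hδ, hball⟩ := Metric.eventually_nhds_iff.1 (hp.2 ε hε)
  refine Metric.eventually_nhds_iff.2 ⟨δ, hδ, fun z hz => ?_⟩
  by_cases hzt : f z = ⊤
  · rw [hzt]; exact le_top
  obtain ⟨A, hA⟩ : ∃ A : ℝ, f u = A := ⟨_, (EReal.coe_toReal hp.1 (hbot _)).symm⟩
  obtain ⟨B, hB⟩ : ∃ B : ℝ, f z = B := ⟨_, (EReal.coe_toReal hzt (hbot _)).symm⟩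
  rw [dist_eq_norm] at hz
  have hzu := hdist z u
  have key : ∀ᶠ i in (U : Filter (Finset X × ℕ)),
      A + (p (L i z) - p u) - ε * ‖L i z - u‖ ≤ B + 1 / ((i.2 : ℝ) + 1) := by
    filter_upwards [hmem z, hzu.eventually (gt_mem_nhds hz)] with i h1 h2
    have h3 := hball (y := L i z) (by rw [dist_eq_norm]; exact h2)
    have h4 : f u + ((p (L i z - u) : ℝ) : EReal) - ((ε * ‖L i z - u‖ : ℝ) : EReal) ≤ _ :=
      le_trans h3 (hL3 i z h1 hzt)
    rw [hA, hB, map_sub] at h4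
    exact_mod_cast h4
  have hlim := le_of_tendsto_of_tendsto ((((hq z).sub_const (p u)).const_add A).sub
    (hzu.const_mul ε)) (hη.const_add B) key
  rw [hA, hB, hQ]
  have e : q (z - u) = q z - p u := by
    have := Q.map_sub z u
    rw [hQ, hQ, hQ, hqY] at this; exact this
  rw [e]
  rw [add_zero] at hlim
  exact_mod_cast hlim

end SepRed

section SepRed2

variable {X : Type*} [NormedAddCommGroup X] [NormedSpace ℝ X]

theorem reflect_step (f : X → EReal) (hbot : ∀ x, f x ≠ ⊥) (E : Set X) (hE : E.Countable) :
    ∃ E' : Set X, E'.Countable ∧ E ⊆ E' ∧ (Submodule.span ℝ E : Set X) ⊆ closure E' ∧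
      ∀ (G : Finset X) (η : ℝ), 0 < η → ∃ L : X → X, (∀ x ∈ G, L x ∈ E') ∧
        (∀ x ∈ G, ∀ u ∈ G, u ∈ E → |‖L x - u‖ - ‖x - u‖| ≤ η) ∧
        (∀ x ∈ G, ∀ y ∈ G, x + y ∈ G → ‖L (x + y) - L x - L y‖ ≤ η) ∧
        (∀ x ∈ G, f x ≠ ⊤ → f (L x) ≤ f x + (η : EReal)) := by
  classical
  obtain ⟨D, hDc, hDd⟩ : ∃ D : Set X, D.Countable ∧ (Submodule.span ℝ E : Set X) ⊆ closure D :=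
    hE.isSeparable.span
  obtain ⟨e, he⟩ := (hE.insert 0).exists_eq_range (Set.insert_nonempty 0 E)
  let τ : (ℕ → X) → (ℕ × ℕ → ℝ) × (ℕ × ℕ × ℕ → ℝ) × (ℕ → EReal) := fun g =>
    (fun i => ‖g i.1 - e i.2‖, fun i => ‖g i.1 - g i.2.1 - g i.2.2‖, fun i => f (g i))
  haveI : Nonempty (Set.range τ) := ⟨⟨τ 0, 0, rfl⟩⟩
  choose d hd using fun n => (TopologicalSpace.denseSeq (Set.range τ) n).2
  have hdense : ∀ (g : ℕ → X) (P : (ℕ × ℕ → ℝ) × (ℕ × ℕ × ℕ → ℝ) × (ℕ → EReal) → Prop),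
      (∀ᶠ t in 𝓝 (τ g), P t) → ∃ n, P (τ (d n)) := by
    intro g P hP
    have h1 := TopologicalSpace.denseRange_denseSeq (Set.range τ) ⟨τ g, g, rfl⟩
    rw [mem_closure_iff_frequently] at h1
    have h2 : ∀ᶠ a in 𝓝 (⟨τ g, g, rfl⟩ : Set.range τ), P a.1 :=
      (continuous_subtype_val.tendsto _).eventually hP
    obtain ⟨a, ⟨n, rfl⟩, h4⟩ := (h1.and_eventually h2).exists
    exact ⟨n, by rw [hd n]; exact h4⟩
  refine ⟨E ∪ D ∪ Set.range (fun i : ℕ × ℕ => d i.1 i.2),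
    (hE.union hDc).union (Set.countable_range _), fun x hx => Or.inl (Or.inl hx),
    hDd.trans (closure_mono fun x hx => Or.inl (Or.inr hx)), ?_⟩
  intro G η hη
  obtain ⟨g, hg⟩ := (G.countable_toSet.insert 0).exists_eq_range (Set.insert_nonempty 0 _)
  have h1 : ∀ x : X, ∃ j, x ∈ G → g j = x := by
    intro x
    by_cases hx : x ∈ G
    · have : x ∈ Set.range g := by rw [← hg]; exact Or.inr hx
      obtain ⟨j, hj⟩ := this
      exact ⟨j, fun _ => hj⟩
    · exact ⟨0, fun h => absurd h hx⟩
  have h2 : ∀ x : X, ∃ j, x ∈ E → e j = x := by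
    intro x
    by_cases hx : x ∈ E
    · have : x ∈ Set.range e := by rw [← he]; exact Or.inr hx
      obtain ⟨j, hj⟩ := this
      exact ⟨j, fun _ => hj⟩
    · exact ⟨0, fun h => absurd h hx⟩
  choose a ha using h1
  choose b hb using h2
  obtain ⟨n, hn1, hn2, hn3⟩ := hdense g (fun t =>
    (∀ x ∈ G, ∀ u ∈ G, u ∈ E → |t.1 (a x, b u) - ‖x - u‖| ≤ η) ∧
    (∀ x ∈ G, ∀ y ∈ G, x + y ∈ G → t.2.1 (a (x + y), a x, a y) ≤ η) ∧
    (∀ x ∈ G, f x ≠ ⊤ → t.2.2 (a x) ≤ f x + (η : EReal))) (by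
      refine Eventually.and ?_ (Eventually.and ?_ ?_)
      · rw [eventually_all_finset]; intro x hx
        rw [eventually_all_finset]; intro u hu
        by_cases huE : u ∈ E
        · have hc : Continuous fun t : (ℕ × ℕ → ℝ) × (ℕ × ℕ × ℕ → ℝ) × (ℕ → EReal) =>
            |t.1 (a x, b u) - ‖x - u‖| := by fun_prop
          have h0 : |(τ g).1 (a x, b u) - ‖x - u‖| < η := by
            simp only [τ]; rw [ha x hx, hb u huE, sub_self, abs_zero]; exact hη
          filter_upwards [hc.continuousAt.eventually (gt_mem_nhds h0)] with t ht _
          exact ht.le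
        · exact Eventually.of_forall fun t h => absurd h huE
      · rw [eventually_all_finset]; intro x hx
        rw [eventually_all_finset]; intro y hy
        by_cases hxy : x + y ∈ G
        · have hc : Continuous fun t : (ℕ × ℕ → ℝ) × (ℕ × ℕ × ℕ → ℝ) × (ℕ → EReal) =>
            t.2.1 (a (x + y), a x, a y) := by fun_prop
          have h0 : (τ g).2.1 (a (x + y), a x, a y) < η := by
            simp only [τ]; rw [ha x hx, ha y hy, ha _ hxy]; simpa using hη
          filter_upwards [hc.continuousAt.eventually (gt_mem_nhds h0)] with t ht _
          exact ht.le
        · exact Eventually.of_forall fun t h => absurd h hxy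
      · rw [eventually_all_finset]; intro x hx
        by_cases hxt : f x = ⊤
        · exact Eventually.of_forall fun t h => absurd hxt h
        · have hc : Continuous fun t : (ℕ × ℕ → ℝ) × (ℕ × ℕ × ℕ → ℝ) × (ℕ → EReal) =>
            t.2.2 (a x) := by fun_prop
          have h0 : (τ g).2.2 (a x) < f x + (η : EReal) := by
            simp only [τ]; rw [ha x hx]
            obtain ⟨B, hB⟩ : ∃ B : ℝ, f x = B := ⟨_, (EReal.coe_toReal hxt (hbot _)).symm⟩
            rw [hB]
            exact_mod_cast lt_add_of_pos_right B hη
          filter_upwards [hc.continuousAt.eventually (gt_mem_nhds h0)] with t ht _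
          exact ht.le)
  refine ⟨fun x => d n (a x), fun x _ => Or.inr ⟨(n, a x), rfl⟩, ?_, ?_, ?_⟩
  · intro x hx u hu huE
    have := hn1 x hx u hu huE
    simp only [τ] at this
    rwa [hb u huE] at this
  · intro x hx y hy hxy
    exact hn2 x hx y hy hxy
  · intro x hx hxt
    exact hn3 x hx hxt

theorem exists_reflects (f : X → EReal) (hbot : ∀ x, f x ≠ ⊥) (x y : X) :
    ∃ Y : Submodule ℝ X, x ∈ Y ∧ y ∈ Y ∧ IsClosed (Y : Set X) ∧
      TopologicalSpace.SeparableSpace Y ∧ Reflects f Y := by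
  classical
  choose S hSc hSsub hSspan hSL using
    fun E : {E : Set X // E.Countable} => reflect_step f hbot E.1 E.2
  let F : ℕ → {E : Set X // E.Countable} := fun n =>
    Nat.rec ⟨{x, y}, (Set.toFinite {x, y}).countable⟩ (fun _ E => ⟨S E, hSc E⟩) n
  have hF0 : (F 0).1 = {x, y} := rfl
  have hFs : ∀ n, (F (n + 1)).1 = S (F n) := fun n => rfl
  have hmono : Monotone fun n => (F n).1 := monotone_nat_of_le_succ fun n => by
    simp only [hFs]; exact hSsub (F n)
  let W : Set X := ⋃ n, (F n).1
  have hWc : W.Countable := Set.countable_iUnion fun n => (F n).2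
  let Y : Submodule ℝ X := (Submodule.span ℝ W).topologicalClosure
  have hWY : W ⊆ Y := Submodule.subset_span.trans (Submodule.le_topologicalClosure _)
  have hYW : (Y : Set X) ⊆ closure W := by
    rw [Submodule.topologicalClosure_coe]
    refine closure_minimal ?_ isClosed_closure
    have e : Submodule.span ℝ W = ⨆ n, Submodule.span ℝ (F n).1 := Submodule.span_iUnion _
    intro z hz
    rw [SetLike.mem_coe, e, Submodule.mem_iSup_of_directed _
      (Monotone.directed_le fun m n h => Submodule.span_mono (hmono h))] at hz
    obtain ⟨n, hn⟩ := hz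
    exact closure_mono (Set.subset_iUnion (fun n => (F n).1) (n + 1)) (hSspan (F n) hn)
  refine ⟨Y, hWY (Set.mem_iUnion.2 ⟨0, by rw [hF0]; simp⟩),
    hWY (Set.mem_iUnion.2 ⟨0, by rw [hF0]; simp⟩), Submodule.isClosed_topologicalClosure _, ?_, ?_⟩
  · exact (hWc.isSeparable.closure.mono hYW).separableSpace
  · intro G η hη
    have happ : ∀ u : X, ∃ u', u ∈ Y → u' ∈ W ∧ ‖u - u'‖ ≤ η / 3 := by
      intro u
      by_cases hu : u ∈ Y
      · obtain ⟨u', h1, h2⟩ := Metric.mem_closure_iff.1 (hYW hu) (η / 3) (by positivity)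
        exact ⟨u', fun _ => ⟨h1, by rw [← dist_eq_norm]; exact h2.le⟩⟩
      · exact ⟨0, fun h => absurd h hu⟩
    choose c hc using happ
    have hn : ∀ u : X, ∃ n, u ∈ Y → c u ∈ (F n).1 := by
      intro u
      by_cases hu : u ∈ Y
      · obtain ⟨n, hn⟩ := Set.mem_iUnion.1 (hc u hu).1
        exact ⟨n, fun _ => hn⟩
      · exact ⟨0, fun h => absurd h hu⟩
    choose ν hν using hn
    obtain ⟨L, hL0, hL1, hL2, hL3⟩ := hSL (F (G.sup ν)) (G ∪ G.image c) (η / 3) (by positivity)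
    have hLY : ∀ z ∈ G, L z ∈ Y := fun z hz =>
      hWY (Set.mem_iUnion.2 ⟨G.sup ν + 1, hL0 z (Finset.mem_union_left _ hz)⟩)
    refine ⟨fun z => if h : L z ∈ Y then ⟨L z, h⟩ else 0, ?_, ?_, ?_⟩
    · intro z hz u hu
      simp only [dif_pos (hLY z hz)]
      have hcu := hc u u.2
      have h1 := hL1 z (Finset.mem_union_left _ hz) (c u)
        (Finset.mem_union_right _ (Finset.mem_image_of_mem c hu))
        (hmono (Finset.le_sup hu) (hν u u.2))
      have h2 : |‖L z - u‖ - ‖L z - c u‖| ≤ η / 3 := by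
        refine (abs_norm_sub_norm_le _ _).trans ?_
        rw [sub_sub_sub_cancel_left, norm_sub_rev]; exact hcu.2
      have h3 : |‖z - u‖ - ‖z - c u‖| ≤ η / 3 := by
        refine (abs_norm_sub_norm_le _ _).trans ?_
        rw [sub_sub_sub_cancel_left, norm_sub_rev]; exact hcu.2
      rw [abs_le] at h1 h2 h3 ⊢
      constructor <;> linarith [h1.1, h1.2, h2.1, h2.2, h3.1, h3.2]
    · intro z hz w hw hzw
      simp only [dif_pos (hLY z hz), dif_pos (hLY w hw), dif_pos (hLY _ hzw)]
      have := hL2 z (Finset.mem_union_left _ hz) w (Finset.mem_union_left _ hw)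
        (Finset.mem_union_left _ hzw)
      linarith
    · intro z hz hzt
      simp only [dif_pos (hLY z hz)]
      refine (hL3 z (Finset.mem_union_left _ hz) hzt).trans ?_
      gcongr
      exact_mod_cast (by linarith : η / 3 ≤ η)

end SepRed2

theorem quasiconvex_of_quasimonotone
    {X : Type*} [NormedAddCommGroup X] [NormedSpace ℝ X] [CompleteSpace X]
    (hX : IsAsplund X) (φ : X → EReal) (hnobot : ∀ x, φ x ≠ ⊥)
    (hlsc : LowerSemicontinuous φ)
    (hmono : ∀ x y : X, ∀ xs ∈ FrechetSubdiff φ x, ∀ ys ∈ FrechetSubdiff φ y,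
        min (xs (y - x)) (ys (x - y)) ≤ 0) : QuasiconvexFn φ := by
  intro x y l hl0 hl1
  obtain ⟨Y, hx, hy, hYc, hYs, hR⟩ := exists_reflects φ hnobot x y
  haveI := hX Y hYc hYs
  haveI : CompleteSpace Y := hYc.completeSpace_coe
  obtain ⟨θ, P, hθ⟩ := exists_smoothGauge (X := Y)
  have hq : QuasiconvexFn (fun z : Y => φ z) := by
    refine quasiconvex_of_quasimonotone_aux hθ _ (hlsc.comp continuous_subtype_val)
      (fun z => hnobot z) ?_
    intro u v us hus vs hvs
    obtain ⟨q, hq, hq'⟩ := hR.extend hnobot u us hus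
    obtain ⟨q2, hq2, hq2'⟩ := hR.extend hnobot v vs hvs
    have := hmono u v q hq q2 hq2
    rw [← hq', ← hq2']
    exact this
  exact hq ⟨x, hx⟩ ⟨y, hy⟩ l hl0 hl1

theorem subdiff_of_quasiconvex
    {X : Type*} [NormedAddCommGroup X] [NormedSpace ℝ X]
    (φ : X → EReal) (hnobot : ∀ x, φ x ≠ ⊥) (hq : QuasiconvexFn φ)
    (x y : X) (hxy : φ y ≤ φ x) (xs : X →L[ℝ] ℝ) (hxs : xs ∈ FrechetSubdiff φ x) :
    xs (y - x) ≤ 0 := by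
  have key : ∀ ε : ℝ, 0 < ε → xs (y - x) ≤ ε * ‖y - x‖ := by
    intro ε hε
    have h1 := hxs.2 ε hε
    have hc : Tendsto (fun t : ℝ => x + t • (y - x)) (𝓝[>] 0) (𝓝 x) := by
      have : Continuous fun t : ℝ => x + t • (y - x) := by fun_prop
      have := this.tendsto 0
      simp only [zero_smul, add_zero] at this
      exact this.mono_left nhdsWithin_le_nhds
    have h2 := hc.eventually h1
    have h3 : Set.Ioo (0:ℝ) 1 ∈ 𝓝[>] (0:ℝ) := Ioo_mem_nhdsGT one_pos
    obtain ⟨t, ht, ht0, ht1⟩ := (h2.and h3).exists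
    have e : x + t • (y - x) = t • y + (1 - t) • x := by module
    have h4 := hq y x t ht0 ht1
    rw [max_eq_right hxy, ← e] at h4
    have h5 := ht.trans h4
    obtain ⟨A, hA⟩ : ∃ A : ℝ, φ x = A := ⟨_, (EReal.coe_toReal hxs.1 (hnobot _)).symm⟩
    rw [hA, add_sub_cancel_left, map_smul, norm_smul, Real.norm_eq_abs, abs_of_pos ht0,
      smul_eq_mul] at h5
    have h6 : A + t * xs (y - x) - ε * (t * ‖y - x‖) ≤ A := by exact_mod_cast h5
    have h7 : t * xs (y - x) ≤ t * (ε * ‖y - x‖) := by linarith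
    exact le_of_mul_le_mul_left h7 ht0
  by_contra! hpos
  have h1 := key (xs (y - x) / (2 * (‖y - x‖ + 1))) (by positivity)
  rw [div_mul_eq_mul_div, le_div_iff₀ (by positivity)] at h1
  nlinarith [norm_nonneg (y - x)]

/-- Theorem 2.5: in an Asplund space, for a proper lsc function `φ`, the
quasiconvexity of `φ`, the first-order condition (b), and the quasimonotonicity
of `∂̂φ` are all equivalent. -/
theorem quasiconvex_characterizations
    {X : Type*} [NormedAddCommGroup X] [NormedSpace ℝ X] [CompleteSpace X]
    (hX : IsAsplund X) (φ : X → EReal)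
    (hproper : ∃ x, φ x ≠ ⊤) (hnobot : ∀ x, φ x ≠ ⊥)
    (hlsc : LowerSemicontinuous φ) :
    (QuasiconvexFn φ ↔
      ∀ x y : X, φ y ≤ φ x → ∀ xs ∈ FrechetSubdiff φ x, xs (y - x) ≤ 0) ∧
    (QuasiconvexFn φ ↔
      ∀ x y : X, ∀ xs ∈ FrechetSubdiff φ x, ∀ ys ∈ FrechetSubdiff φ y,
        min (xs (y - x)) (ys (x - y)) ≤ 0) := by
  have hab : QuasiconvexFn φ →
      ∀ x y : X, φ y ≤ φ x → ∀ xs ∈ FrechetSubdiff φ x, xs (y - x) ≤ 0 :=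
    fun hq x y hxy xs hxs => subdiff_of_quasiconvex φ hnobot hq x y hxy xs hxs
  have hbc : (∀ x y : X, φ y ≤ φ x → ∀ xs ∈ FrechetSubdiff φ x, xs (y - x) ≤ 0) →
      ∀ x y : X, ∀ xs ∈ FrechetSubdiff φ x, ∀ ys ∈ FrechetSubdiff φ y,
        min (xs (y - x)) (ys (x - y)) ≤ 0 := by
    intro h x y xs hxs ys hys
    rcases le_total (φ y) (φ x) with h1 | h1
    · exact (min_le_left _ _).trans (h x y h1 xs hxs)
    · exact (min_le_right _ _).trans (h y x h1 ys hys)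
  have hca := quasiconvex_of_quasimonotone hX φ hnobot hlsc
  exact ⟨⟨hab, fun h => hca (hbc h)⟩, ⟨fun h => hbc (hab h), hca⟩⟩
end

section
/- Let X be a real Banach space, φ : X → ℝ ∪ {+∞} a quasiconvex function, and u, v, w ∈ X with v ∈ (u,w) and φ(u) ≤ φ(w). Suppose there exist v* ∈ X* and z ∈ (u,v) such that φ_{v*}(z) > max{φ_{v*}(u), φ_{v*}(w)}, where φ_{v*}(x) := φ(x) + ⟨v*, x⟩. Then φ(u) < φ(z) ≤ φ(v) ≤ φ(w). -/
open Filter Topology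

/-- Lemma 3.2: if `φ` is quasiconvex, `v ∈ (u,w)`, `φ u ≤ φ w`, and there are
`v*` and `z ∈ (u,v)` with `φ_{v*}(z) > max{φ_{v*}(u), φ_{v*}(w)}`, then
`φ u < φ z ≤ φ v ≤ φ w`. -/
theorem quasiconvex_perturbation_chain
    {X : Type*} [NormedAddCommGroup X] [NormedSpace ℝ X] [CompleteSpace X]
    (φ : X → EReal) (hqc : QuasiconvexFn φ)
    (u v w : X) (hv : v ∈ openSegment ℝ u w) (huw : φ u ≤ φ w)
    (vs : X →L[ℝ] ℝ) (z : X) (hz : z ∈ openSegment ℝ u v)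
    (hineq : max (φ u + ↑(vs u)) (φ w + ↑(vs w)) < φ z + ↑(vs z)) :
    φ u < φ z ∧ φ z ≤ φ v ∧ φ v ≤ φ w := by
  have key : ∀ x y p : X, p ∈ openSegment ℝ x y → φ p ≤ max (φ x) (φ y) := by
    rintro x y p ⟨a, b, ha, hb, hab, rfl⟩
    have hb' : b = 1 - a := by linarith
    subst hb'
    exact hqc x y a ha (by linarith)
  have hvw : φ v ≤ φ w := (key u w v hv).trans (max_le huw le_rfl)
  have hlt : ∀ x : X, φ z ≤ φ x → φ x + ↑(vs x) < φ z + ↑(vs z) → vs x < vs z := by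
    intro x hx h
    by_contra hc
    push Not at hc
    exact absurd h (not_lt.mpr (add_le_add hx (EReal.coe_le_coe_iff.mpr hc)))
  have huz : φ u < φ z := by
    by_contra hc
    push Not at hc
    have h1 := hlt u hc ((le_max_left _ _).trans_lt hineq)
    have h2 := hlt w (hc.trans huw) ((le_max_right _ _).trans_lt hineq)
    obtain ⟨a, b, ha, hb, hab, hz'⟩ := hz
    obtain ⟨c, d, hc', hd, hcd, hv'⟩ := hv
    have e1 : vs z = a * vs u + b * vs v := by rw [← hz']; simp
    have e2 : vs v = c * vs u + d * vs w := by rw [← hv']; simp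
    have h3 : vs v < vs z := by
      have ec : c = 1 - d := by linarith
      subst ec
      nlinarith
    have ea : a = 1 - b := by linarith
    subst ea
    nlinarith
  refine ⟨huz, ?_, hvw⟩
  rcases le_max_iff.mp (key u v z hz) with h | h
  · exact absurd huz (not_lt.mpr h)
  · exact h
end

section
/- Let X be a real Banach space, φ : X → ℝ ∪ {+∞} a quasiconvex, proper, lower semicontinuous function, and v* ∈ X*. If the function φ_{v*} : x ↦ φ(x) + ⟨v*, x⟩ is not quasiconvex, then there exist u, v, w ∈ X with v ∈ (u,w) such that: (i) φ(w) ≥ φ(v) > φ(u); (ii) φ_{v*}(v) > max{φ_{v*}(u), φ_{v*}(w)}; and (iii) for every γ > 0 there exists v_γ ∈ B_γ(v) ∩ (v,w) with φ_{v*}(v) > φ_{v*}(v_γ). -/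
open Filter Topology

lemma real_aux (f : ℝ → ℝ) (c t0 : ℝ)
    (hq : ∀ a s b : ℝ, 0 ≤ a → a < s → s < b → b ≤ 1 → f s ≤ max (f a) (f b))
    (h0 : 0 < t0) (h1 : t0 < 1) (hf0 : f 0 < f t0) (hf1 : f t0 ≤ f 1)
    (hc : f 1 + c < f t0 + c * t0) :
    ∃ s, t0 ≤ s ∧ s < 1 ∧ f t0 ≤ f s ∧ f s ≤ f 1 ∧ f t0 + c * t0 ≤ f s + c * s ∧
      ∀ t, s < t → t ≤ 1 → f t + c * t < f s + c * s := by
  have hge : ∀ s, t0 ≤ s → s ≤ 1 → f t0 ≤ f s := by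
    intro s hs hs1
    rcases hs.eq_or_lt with rfl | hs
    · exact le_rfl
    · rcases le_max_iff.1 (hq 0 t0 s le_rfl h0 hs hs1) with h | h
      · linarith
      · exact h
  have hmono : ∀ s t, t0 ≤ s → s ≤ t → t ≤ 1 → f s ≤ f t := by
    intro s t hs hst ht
    rcases hst.eq_or_lt with rfl | hst
    · exact le_rfl
    · rcases le_max_iff.1 (hq 0 s t le_rfl (by linarith) hst ht) with h | h
      · linarith [hge s hs (by linarith)]
      · exact h
  have hcneg : c < 0 := by nlinarith
  let S : Set ℝ := {t | t0 ≤ t ∧ t ≤ 1 ∧ f t0 + c * t0 ≤ f t + c * t}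
  have hS0 : t0 ∈ S := ⟨le_rfl, h1.le, le_rfl⟩
  have hSb : BddAbove S := ⟨1, fun t ht => ht.2.1⟩
  have hle : t0 ≤ sSup S := le_csSup hSb hS0
  have hle1 : sSup S ≤ 1 := csSup_le ⟨t0, hS0⟩ fun t ht => ht.2.1
  have hval : f t0 + c * t0 ≤ f (sSup S) + c * sSup S := by
    by_contra hcon
    push Not at hcon
    obtain ⟨t, ht, hlt⟩ := exists_lt_of_lt_csSup (s := S)
      (b := sSup S - (f t0 + c * t0 - (f (sSup S) + c * sSup S)) / (-c)) ⟨t0, hS0⟩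
      (by
        have := div_pos (sub_pos.2 hcon) (neg_pos.2 hcneg)
        linarith)
    have h2 := hmono t (sSup S) ht.1 (le_csSup hSb ht) hle1
    have h3 := ht.2.2
    have h4 : sSup S - t < (f t0 + c * t0 - (f (sSup S) + c * sSup S)) / (-c) := by linarith
    rw [lt_div_iff₀ (neg_pos.2 hcneg)] at h4
    nlinarith
  refine ⟨sSup S, hle, ?_, hge _ hle hle1, hmono _ _ hle hle1 le_rfl, hval, ?_⟩
  · rcases hle1.eq_or_lt with h | h
    · rw [h] at hval
      linarith
    · exact h
  · intro t hst ht1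
    by_contra hcon
    push Not at hcon
    have : t ∈ S := ⟨by linarith, ht1, by linarith⟩
    linarith [le_csSup hSb this]

lemma seg_aux {X : Type*} [NormedAddCommGroup X] [NormedSpace ℝ X]
    (φ : X → EReal) (hqc : QuasiconvexFn φ) (hnobot : ∀ x, φ x ≠ ⊥)
    (vs : X →L[ℝ] ℝ) (u w : X) (t0 : ℝ) (h0 : 0 < t0) (h1 : t0 < 1)
    (hu : φ u ≠ ⊤) (hw : φ w ≠ ⊤)
    (hz : φ (AffineMap.lineMap u w t0) ≤ φ w)
    (hm : max (φ u + ↑(vs u)) (φ w + ↑(vs w)) <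
      φ (AffineMap.lineMap u w t0) + ↑(vs (AffineMap.lineMap u w t0))) :
    ∃ u v w : X, v ∈ openSegment ℝ u w ∧
      (φ v ≤ φ w ∧ φ u < φ v) ∧
      max (φ u + ↑(vs u)) (φ w + ↑(vs w)) < φ v + ↑(vs v) ∧
      ∀ γ : ℝ, 0 < γ → ∃ vg ∈ Metric.ball v γ ∩ openSegment ℝ v w,
        φ vg + ↑(vs vg) < φ v + ↑(vs v) := by
  let L : ℝ → X := fun t => AffineMap.lineMap u w t
  let f : ℝ → ℝ := fun t => (φ (L t)).toReal
  have hL0 : L 0 = u := AffineMap.lineMap_apply_zero u w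
  have hL1 : L 1 = w := AffineMap.lineMap_apply_one u w
  have hLt : ∀ t, L t = u + t • (w - u) := fun t => by
    simp [L, AffineMap.lineMap_apply, add_comm]
  have hcomb : ∀ a b l : ℝ, l • L a + (1 - l) • L b = L (l * a + (1 - l) * b) := by
    intro a b l
    simp only [hLt]
    module
  have hqc' : ∀ a s b : ℝ, a < s → s < b → φ (L s) ≤ max (φ (L a)) (φ (L b)) := by
    intro a s b has hsb
    have hba : 0 < b - a := by linarith
    have := hqc (L a) (L b) ((b - s) / (b - a)) (div_pos (by linarith) hba)
      (by rw [div_lt_one hba]; linarith)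
    rw [hcomb] at this
    convert this using 3
    field_simp
    ring
  have hfin : ∀ t, 0 ≤ t → t ≤ 1 → φ (L t) ≠ ⊤ := by
    intro t ht0 ht1
    rcases ht0.eq_or_lt with rfl | ht0
    · rwa [hL0]
    rcases ht1.eq_or_lt with rfl | ht1
    · rwa [hL1]
    have := hqc' 0 t 1 ht0 ht1
    rw [hL0, hL1] at this
    exact ne_of_lt (this.trans_lt (max_lt hu.lt_top hw.lt_top))
  have hco : ∀ t, 0 ≤ t → t ≤ 1 → φ (L t) = ((f t : ℝ) : EReal) := fun t a b =>
    (EReal.coe_toReal (hfin t a b) (hnobot _)).symm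
  have hvs : ∀ t, vs (L t) = vs u + (vs w - vs u) * t := by
    intro t
    rw [hLt]
    simp
    ring
  have hsum : ∀ t, 0 ≤ t → t ≤ 1 →
      φ (L t) + ↑(vs (L t)) = ((f t + (vs u + (vs w - vs u) * t) : ℝ) : EReal) := by
    intro t a b
    rw [hco t a b, hvs, ← EReal.coe_add]
  have eu := hsum 0 le_rfl zero_le_one
  have ew := hsum 1 zero_le_one le_rfl
  have ez := hsum t0 h0.le h1.le
  rw [hL0] at eu
  rw [hL1] at ew
  change φ (L t0) ≤ _ at hz
  change _ < φ (L t0) + ↑(vs (L t0)) at hm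
  obtain ⟨hm1, hm2⟩ := max_lt_iff.1 hm
  rw [eu, ez, EReal.coe_lt_coe_iff] at hm1
  rw [ew, ez, EReal.coe_lt_coe_iff] at hm2
  have hz' : f t0 ≤ f 1 := by
    rw [← hL1, hco _ h0.le h1.le, hco _ zero_le_one le_rfl, EReal.coe_le_coe_iff] at hz
    exact hz
  have hcneg : vs w - vs u < 0 := by nlinarith
  obtain ⟨s, hs0, hs1, hfs, hfs1, hval, hafter⟩ := real_aux f (vs w - vs u) t0
    (by
      intro a s b ha has hsb hb
      have := hqc' a s b has hsb
      rw [hco a ha (by linarith), hco b (by linarith) hb, hco s (by linarith) (by linarith)] at this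
      rw [le_max_iff, EReal.coe_le_coe_iff, EReal.coe_le_coe_iff, ← le_max_iff] at this
      exact this) h0 h1 (by nlinarith) hz' (by linarith)
  have hsp : 0 < s := by linarith
  refine ⟨u, L s, w, ?_, ⟨?_, ?_⟩, ?_, ?_⟩
  · rw [openSegment_eq_image_lineMap]
    exact ⟨s, ⟨hsp, hs1⟩, rfl⟩
  · rw [← hL1, hco _ hsp.le hs1.le, hco _ zero_le_one le_rfl, EReal.coe_le_coe_iff]
    exact hfs1
  · rw [← hL0, hco _ hsp.le hs1.le, hco _ le_rfl zero_le_one, EReal.coe_lt_coe_iff]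
    nlinarith
  · rw [eu, ew, hsum s hsp.le hs1.le]
    refine max_lt ?_ ?_ <;> rw [EReal.coe_lt_coe_iff] <;> linarith
  · intro γ hγ
    have hcont : ContinuousAt L s := by
      have : L = fun t => u + t • (w - u) := funext hLt
      rw [this]
      fun_prop
    obtain ⟨δ, hδ, hball⟩ := Metric.continuousAt_iff.1 hcont γ hγ
    let t := s + min (δ / 2) ((1 - s) / 2)
    have hmp : 0 < min (δ / 2) ((1 - s) / 2) := lt_min (by linarith) (by linarith)
    have hst : s < t := by simp only [t]; linarith
    have ht1 : t < 1 := by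
      simp only [t]
      linarith [min_le_right (δ / 2) ((1 - s) / 2)]
    have htd : t - s < δ := by
      simp only [t]
      linarith [min_le_left (δ / 2) ((1 - s) / 2)]
    refine ⟨L t, ⟨?_, ?_⟩, ?_⟩
    · apply hball
      rw [Real.dist_eq, abs_of_pos (by linarith)]
      exact htd
    · refine ⟨(1 - t) / (1 - s), (t - s) / (1 - s), div_pos (by linarith) (by linarith),
        div_pos (by linarith) (by linarith), ?_, ?_⟩
      · have : (1 - s) ≠ 0 := by linarith
        field_simp
        ring
      · have hne : (1 - s) ≠ 0 := by linarith
        have e : (t - s) / (1 - s) = 1 - (1 - t) / (1 - s) := by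
          field_simp
          ring
        rw [← hL1, e, hcomb]
        congr 1
        field_simp
        ring
    · rw [hsum s hsp.le hs1.le, hsum t (by linarith) ht1.le, EReal.coe_lt_coe_iff]
      linarith [hafter t hst ht1.le]

/-- Lemma 3.3: if `φ` is quasiconvex, proper and lsc, and `φ_{v*}` is not
quasiconvex, then there are `u, v, w` with `v ∈ (u,w)` satisfying
`φ w ≥ φ v > φ u`, `φ_{v*}(v) > max{φ_{v*}(u), φ_{v*}(w)}`, and for every `γ > 0`
there is `v_γ ∈ B_γ(v) ∩ (v,w)` with `φ_{v*}(v) > φ_{v*}(v_γ)`. -/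
theorem not_quasiconvex_perturbed
    {X : Type*} [NormedAddCommGroup X] [NormedSpace ℝ X] [CompleteSpace X]
    (φ : X → EReal)
    (hqc : QuasiconvexFn φ)
    (hproper : ∃ x, φ x ≠ ⊤) (hnobot : ∀ x, φ x ≠ ⊥)
    (hlsc : LowerSemicontinuous φ)
    (vs : X →L[ℝ] ℝ) (hnot : ¬ QuasiconvexFn (fun z => φ z + ↑(vs z))) :
    ∃ u v w : X, v ∈ openSegment ℝ u w ∧
      (φ v ≤ φ w ∧ φ u < φ v) ∧
      max (φ u + ↑(vs u)) (φ w + ↑(vs w)) < φ v + ↑(vs v) ∧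
      ∀ γ : ℝ, 0 < γ → ∃ vg ∈ Metric.ball v γ ∩ openSegment ℝ v w,
        φ vg + ↑(vs vg) < φ v + ↑(vs v) := by
  unfold QuasiconvexFn at hnot
  push Not at hnot
  obtain ⟨x, y, l, hl0, hl1, hlt⟩ := hnot
  have hx : φ x ≠ ⊤ := by
    intro h
    rw [h, EReal.top_add_coe] at hlt
    simp at hlt
  have hy : φ y ≠ ⊤ := by
    intro h
    rw [h, EReal.top_add_coe] at hlt
    simp at hlt
  have e1 : l • x + (1 - l) • y = AffineMap.lineMap y x l := by
    rw [AffineMap.lineMap_apply_module, add_comm]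
  have e2 : l • x + (1 - l) • y = AffineMap.lineMap x y (1 - l) := by
    rw [AffineMap.lineMap_apply_module]
    simp
  rcases le_max_iff.1 (hqc x y l hl0 hl1) with h | h
  · rw [e1] at h hlt
    rw [max_comm] at hlt
    exact seg_aux φ hqc hnobot vs y x l hl0 hl1 hy hx h hlt
  · rw [e2] at h hlt
    exact seg_aux φ hqc hnobot vs x y (1 - l) (by linarith) (by linarith) hx hy h hlt
end

section
/- Let X be a real Banach space, φ : X → ℝ ∪ {+∞} a proper lower semicontinuous function, and α > 0. If φ is α-robustly quasiconvex, then for all x, y ∈ X with φ(y) ≤ φ(x) and all x* ∈ ∂̂φ(x), one has ⟨x*, y − x⟩ ≤ −min{α‖y − x‖, φ(x) − φ(y)}. -/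
open Filter Topology

/-- Theorem 3.4, (a) ⇒ (b) (valid in any Banach space): if `φ` is `α`-robustly
quasiconvex and `φ y ≤ φ x`, then for every `x* ∈ ∂̂φ(x)` one has
`⟨x*, y - x⟩ ≤ -min{α‖y - x‖, φ x - φ y}`. -/
theorem robustly_quasiconvex_imp_subdiff_cond
    {X : Type*} [NormedAddCommGroup X] [NormedSpace ℝ X] [CompleteSpace X]
    (φ : X → EReal)
    (hproper : ∃ x, φ x ≠ ⊤) (hnobot : ∀ x, φ x ≠ ⊥)
    (hlsc : LowerSemicontinuous φ)
    (α : ℝ) (hα : 0 < α) (hrqc : RobustlyQuasiconvex φ α) :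
    ∀ x y : X, φ y ≤ φ x → ∀ xs ∈ FrechetSubdiff φ x,
      (↑(xs (y - x)) : EReal) ≤ -min (↑(α * ‖y - x‖) : EReal) (φ x - φ y) := by
  intro x y hyx xs hxs
  obtain ⟨hxt, hsub⟩ := hxs
  have hyt : φ y ≠ ⊤ := fun h => hxt (top_le_iff.mp (h ▸ hyx))
  obtain ⟨a, ha⟩ : ∃ a : ℝ, φ x = a := ⟨_, (EReal.coe_toReal hxt (hnobot x)).symm⟩
  obtain ⟨b, hb⟩ : ∃ b : ℝ, φ y = b := ⟨_, (EReal.coe_toReal hyt (hnobot y)).symm⟩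
  have hba : b ≤ a := by rw [ha, hb] at hyx; exact_mod_cast hyx
  have key : xs (y - x) ≤ -min (α * ‖y - x‖) (a - b) := by
    by_cases hd : y - x = 0
    · have h1 : 0 ≤ a - b := by linarith
      simp [hd, h1]
    have hdn : 0 < ‖y - x‖ := norm_pos_iff.mpr hd
    obtain ⟨m, hm⟩ : ∃ m, m = min (α * ‖y - x‖) (a - b) := ⟨_, rfl⟩
    have hm1 : m ≤ α * ‖y - x‖ := hm ▸ min_le_left _ _
    have hm2 : m ≤ a - b := hm ▸ min_le_right _ _
    have hm0 : 0 ≤ m := hm ▸ le_min (by positivity) (by linarith)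
    rw [← hm]
    obtain ⟨g, hg1, hg2⟩ := exists_dual_vector ℝ (y - x) hdn.ne'
    have hg2' : g (y - x) = ‖y - x‖ := by simpa using hg2
    have hq := hrqc ((m / ‖y - x‖) • g) (by
      rw [norm_smul, hg1, mul_one, Real.norm_of_nonneg (by positivity)]
      exact (div_le_iff₀ hdn).mpr hm1)
    have hvd : (m / ‖y - x‖) * g y = (m / ‖y - x‖) * g x + m := by
      have : g y = g x + ‖y - x‖ := by rw [← hg2', map_sub]; ring
      rw [this, mul_add, div_mul_cancel₀ _ hdn.ne']
    apply le_of_forall_pos_le_add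
    intro δ hδ
    have hε : 0 < δ / ‖y - x‖ := by positivity
    have hev := hsub _ hε
    have ht : Tendsto (fun l : ℝ => l • y + (1 - l) • x) (𝓝[>] 0) (𝓝 x) := by
      have : Continuous (fun l : ℝ => l • y + (1 - l) • x) := by fun_prop
      have h2 := this.tendsto 0
      simp only [zero_smul, sub_zero, one_smul, zero_add] at h2
      exact h2.mono_left nhdsWithin_le_nhds
    have hlt : ∀ᶠ l : ℝ in 𝓝[>] 0, l ∈ Set.Ioo (0 : ℝ) 1 :=
      Ioo_mem_nhdsGT one_pos
    obtain ⟨l, hl1, hl0, hl2⟩ := ((ht.eventually hev).and hlt).exists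
    have hq' := hq y x l hl0 hl2
    have hz : l • y + (1 - l) • x - x = l • (y - x) := by module
    rw [hz] at hl1
    simp only [smul_apply, smul_eq_mul, map_add, map_smul, ha, hb,
      norm_smul, Real.norm_of_nonneg hl0.le] at hq' hl1
    have hzt : φ (l • y + (1 - l) • x) ≠ ⊤ := by
      intro h
      rw [h, EReal.top_add_coe, top_le_iff] at hq'
      rcases max_choice ((b : EReal) + ↑(m / ‖y - x‖ * g y)) ((a : EReal) + ↑(m / ‖y - x‖ * g x))
        with h' | h' <;> rw [h'] at hq' <;> exact EReal.coe_ne_top _ hq'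
    obtain ⟨c, hc⟩ : ∃ c : ℝ, φ (l • y + (1 - l) • x) = c :=
      ⟨_, (EReal.coe_toReal hzt (hnobot _)).symm⟩
    rw [hc] at hq' hl1
    have h1 : a + l * xs (y - x) - δ / ‖y - x‖ * (l * ‖y - x‖) ≤ c := by exact_mod_cast hl1
    have h2 : c + m / ‖y - x‖ * (l * g y + (1 - l) * g x) ≤
        max (b + m / ‖y - x‖ * g y) (a + m / ‖y - x‖ * g x) := by
      have h6 : ((c + (l * (m / ‖y - x‖ * g y) + (1 - l) * (m / ‖y - x‖ * g x)) : ℝ) : EReal) ≤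
          ((max (b + m / ‖y - x‖ * g y) (a + m / ‖y - x‖ * g x) : ℝ) : EReal) := by
        rw [EReal.coe_strictMono.monotone.map_max]
        exact_mod_cast hq'
      have h7 := EReal.coe_le_coe_iff.mp h6
      refine le_trans (le_of_eq ?_) h7
      ring
    rw [hvd, max_eq_right (by linarith)] at h2
    have h3 : m / ‖y - x‖ * (l * g y + (1 - l) * g x) = m / ‖y - x‖ * g x + l * m := by
      linear_combination l * hvd
    have h4 : δ / ‖y - x‖ * (l * ‖y - x‖) = l * δ := by field_simp
    rw [h3] at h2
    rw [h4] at h1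
    have h5 : l * xs (y - x) ≤ l * (-m + δ) := by linarith
    exact le_of_mul_le_mul_left h5 hl0
  rw [ha, hb, ← EReal.coe_sub, ← EReal.coe_strictMono.monotone.map_min]
  exact_mod_cast key
end
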